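/- Let (K₁,...,K_N) be the attractor of a graph-directed IFS in ℝⁿ, let i be a vertex such that the transformation group of K_i is finite, and let f : ℝⁿ → ℝᵐ be linear. Then f is almost dimension conserving for K_i; that is, there exists Δ ≥ 0 such that for every ε > 0, Δ + dim{ y ∈ f(K_i) : dim(K_i ∩ f⁻¹(y)) ≥ Δ − ε } ≥ dim K_i. -/

import Mathlib

open Set Metric MeasureTheory Module Filter Topology
open scoped ENNReal NNReal RealInnerProductSpace

noncomputable section

/-- `IsPathFrom src tgt i j p`: the list of edges `p` forms a path from vertex `i` to
vertex `j` in the directed graph with source and target maps `src`, `tgt`. -/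
def IsPathFrom {V Edge : Type*} (src tgt : Edge → V) : V → V → List Edge → Prop
  | i, j, [] => i = j
  | i, j, e :: p => src e = i ∧ IsPathFrom src tgt (tgt e) j p

/-- The transformation group of the vertex `i` of a graph-directed IFS whose similarities
have orthogonal parts `T e`: the subgroup of `O(n)` generated by the compositions
`T e₁ ∘ ⋯ ∘ T e_ℓ` over all (nonempty) paths `(e₁, …, e_ℓ)` from `i` to `i`. -/
def transfGroup {V Edge : Type*} {n : ℕ} (src tgt : Edge → V)
    (T : Edge → (EuclideanSpace ℝ (Fin n) ≃ₗᵢ[ℝ] EuclideanSpace ℝ (Fin n))) (i : V) :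
    Subgroup (EuclideanSpace ℝ (Fin n) ≃ₗᵢ[ℝ] EuclideanSpace ℝ (Fin n)) :=
  Subgroup.closure
    {S | ∃ p : List Edge, p ≠ [] ∧ IsPathFrom src tgt i i p ∧ S = (p.map T).prod}


section CoverLemma

/-- A compact set of small Hausdorff dimension has finite ball covers of small total weight. -/
theorem exists_finite_ball_cover {X : Type*} [MetricSpace X] [Nonempty X]
    {S : Set X} (hS : IsCompact S) {D : ℝ} (h : dimH S < ENNReal.ofReal D ∨ S = ∅)
    {κ : ℝ} (hκ : 0 < κ) :
    ∃ (I : Finset ℕ) (x : ℕ → X) (ρ : ℕ → ℝ), (∀ i ∈ I, 0 < ρ i) ∧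
      S ⊆ ⋃ i ∈ I, ball (x i) (ρ i) ∧ ∑ i ∈ I, ρ i ^ D ≤ κ := by
  classical
  letI : MeasurableSpace X := borel X
  haveI : BorelSpace X := ⟨rfl⟩
  rcases S.eq_empty_or_nonempty with rfl | ⟨x0, hx0⟩
  · exact ⟨∅, fun _ => Classical.arbitrary X, fun _ => 1, by simp, by simp, by simpa using hκ.le⟩
  have h : dimH S < ENNReal.ofReal D := by
    rcases h with h | h
    · exact h
    · simp [h] at hx0
  have hD : 0 < D := by
    by_contra hD
    rw [ENNReal.ofReal_of_nonpos (not_lt.mp hD)] at h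
    simp at h
  have h0 : μH[D] S = 0 := by
    have := hausdorffMeasure_of_dimH_lt (s := S) (d := D.toNNReal) (by simpa [ENNReal.ofReal] using h)
    simpa [Real.coe_toNNReal _ hD.le] using this
  rw [Measure.hausdorffMeasure_apply] at h0
  simp only [ENNReal.iSup_eq_zero] at h0
  have h1 := h0 1 one_pos
  have h2 : (⨅ t : ℕ → Set X,
          ⨅ (_ : S ⊆ ⋃ n, t n), ⨅ (_ : ∀ (n : ℕ), ediam (t n) ≤ 1), ∑' (n : ℕ), ⨆ (_ : (t n).Nonempty), ediam (t n) ^ D) < ENNReal.ofReal (κ / 2) := by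
    rw [h1]; simpa using hκ
  simp only [iInf_lt_iff] at h2
  obtain ⟨t, hcov, hdiam, hsum⟩ := h2
  set d : ℕ → ℝ := fun n => (ediam (t n)).toReal with hd
  have hd0 : ∀ n, 0 ≤ d n := fun n => ENNReal.toReal_nonneg
  have hdfin : ∀ n, ediam (t n) ≠ ∞ := fun n => ne_top_of_le_ne_top ENNReal.one_ne_top (hdiam n)
  have hterm : ∀ n, ENNReal.ofReal (d n ^ D) ≤ ⨆ (_ : (t n).Nonempty), ediam (t n) ^ D := by
    intro n
    rcases (t n).eq_empty_or_nonempty with he | hne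
    · simp [hd, he, Real.zero_rpow hD.ne']
    · simp only [hne, iSup_pos]
      rw [← ENNReal.ofReal_rpow_of_nonneg (hd0 n) hD.le, hd, ENNReal.ofReal_toReal (hdfin n)]
  have hρ : ∀ n, ∃ ρ : ℝ, d n < ρ ∧ ρ ^ D < d n ^ D + κ / 2 / 2 / 2 ^ n := by
    intro n
    have hc : ContinuousAt (fun ρ : ℝ => ρ ^ D) (d n) :=
      Real.continuousAt_rpow_const _ _ (Or.inr hD.le)
    have hpos : 0 < κ / 2 / 2 / 2 ^ n := by positivity
    have hev : ∀ᶠ ρ in 𝓝 (d n), ρ ^ D < d n ^ D + κ / 2 / 2 / 2 ^ n :=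
      hc.eventually_lt continuousAt_const (by simpa using hpos)
    have hev2 : ∀ᶠ ρ in 𝓝[>] (d n), ρ ^ D < d n ^ D + κ / 2 / 2 / 2 ^ n := hev.filter_mono nhdsWithin_le_nhds
    obtain ⟨ρ, h1, h2⟩ := (hev2.and self_mem_nhdsWithin).exists
    exact ⟨ρ, h2, h1⟩
  choose ρ hρ1 hρ2 using hρ
  have hx : ∀ n, ∃ x : X, (t n).Nonempty → x ∈ t n := by
    intro n
    rcases (t n).eq_empty_or_nonempty with he | ⟨y, hy⟩
    · exact ⟨x0, by simp [he]⟩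
    · exact ⟨y, fun _ => hy⟩
  choose x hx using hx
  have hcov2 : S ⊆ ⋃ n, ball (x n) (ρ n) := by
    refine hcov.trans (iUnion_mono fun n y hy => ?_)
    have h1 : edist y (x n) ≤ ediam (t n) := edist_le_ediam_of_mem hy (hx n ⟨y, hy⟩)
    rw [mem_ball, dist_edist]
    exact (ENNReal.toReal_mono (hdfin n) h1).trans_lt (hρ1 n)
  obtain ⟨I, hI⟩ := hS.elim_finite_subcover _ (fun n => isOpen_ball) hcov2
  refine ⟨I, x, ρ, fun i _ => (hd0 i).trans_lt (hρ1 i), hI, ?_⟩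
  have hA : ∑ i ∈ I, d i ^ D ≤ κ / 2 := by
    have : ENNReal.ofReal (∑ i ∈ I, d i ^ D) ≤ ENNReal.ofReal (κ / 2) := by
      rw [ENNReal.ofReal_sum_of_nonneg (fun i _ => Real.rpow_nonneg (hd0 i) _)]
      calc _ ≤ ∑ i ∈ I, ⨆ (_ : (t i).Nonempty), ediam (t i) ^ D := Finset.sum_le_sum fun i _ => hterm i
        _ ≤ _ := ENNReal.sum_le_tsum _
        _ ≤ _ := hsum.le
    exact (ENNReal.ofReal_le_ofReal_iff (by positivity)).1 this
  have hB : ∑ i ∈ I, κ / 2 / 2 / 2 ^ i ≤ κ / 2 :=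
    (summable_geometric_two' (κ / 2)).sum_le_tsum I (fun i _ => by positivity) |>.trans_eq (tsum_geometric_two' _)
  calc ∑ i ∈ I, ρ i ^ D ≤ ∑ i ∈ I, (d i ^ D + κ / 2 / 2 / 2 ^ i) := Finset.sum_le_sum fun i _ => (hρ2 i).le
    _ ≤ κ := by rw [Finset.sum_add_distrib]; linarith

end CoverLemma

section Words

variable {E F : Type*} [NormedAddCommGroup E] [NormedSpace ℝ E]
  [NormedAddCommGroup F] [NormedSpace ℝ F]

/-- The image of `x` under the composition of the maps `y ↦ b + r y`, `b` in the word. -/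
def wpt (r : ℝ) (x : E) : List E → E
  | [] => x
  | b :: w => b + r • wpt r x w

open Classical in
/-- Words of given length in the alphabet `Γ`. -/
def words (Γ : Finset E) : ℕ → Finset (List E)
  | 0 => {[]}
  | k + 1 => (Γ ×ˢ words Γ k).image (fun p => p.1 :: p.2)

theorem mem_words {Γ : Finset E} {k : ℕ} {w : List E} :
    w ∈ words Γ k ↔ w.length = k ∧ ∀ b ∈ w, b ∈ Γ := by
  induction k generalizing w with
  | zero => cases w <;> simp [words]
  | succ k ih =>
    cases w with
    | nil => simp [words]
    | cons b w => simp [words, ih]; tauto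

theorem sum_words_succ (Γ : Finset E) (k : ℕ) (h : List E → ℝ) :
    ∑ w ∈ words Γ (k + 1), h w = ∑ b ∈ Γ, ∑ w ∈ words Γ k, h (b :: w) := by
  classical
  rw [words, Finset.sum_image, Finset.sum_product]
  intro p _ q _ hpq
  simp only [List.cons.injEq] at hpq
  exact Prod.ext hpq.1 hpq.2

theorem card_words (Γ : Finset E) (k : ℕ) : ((words Γ k).card : ℝ) = (Γ.card : ℝ) ^ k := by
  induction k with
  | zero => simp [words]
  | succ k ih =>
    have := sum_words_succ Γ k (fun _ => 1)
    simp only [Finset.sum_const, nsmul_eq_mul, mul_one] at this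
    rw [this, ih]; ring

theorem wpt_append (r : ℝ) (x : E) (u w : List E) :
    wpt r x (u ++ w) = wpt r (wpt r x w) u := by
  induction u with
  | nil => rfl
  | cons b u ih => simp [wpt, ih]

theorem wpt_eq (r : ℝ) (x : E) (u : List E) :
    wpt r x u = wpt r 0 u + r ^ u.length • x := by
  induction u with
  | nil => simp [wpt]
  | cons b u ih => simp only [wpt, List.length_cons]; rw [ih, smul_add, smul_smul, pow_succ']; abel

/-- A homogeneous separated system of maps `x ↦ b + r x` of `K` into itself. -/
structure Sys (K : Set E) (R r : ℝ) (Γ : Finset E) : Prop where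
  r_pos : 0 < r
  r_le : r ≤ 1 / 4
  maps : ∀ b ∈ Γ, ∀ x ∈ K, b + r • x ∈ K
  sep : ∀ b ∈ Γ, ∀ b' ∈ Γ, b ≠ b' → 4 * R * r ≤ ‖b - b'‖

variable {K : Set E} {R r : ℝ} {Γ : Finset E}

theorem Sys.wpt_mem (h : Sys K R r Γ) {k : ℕ} {w : List E} (hw : w ∈ words Γ k) {x : E}
    (hx : x ∈ K) : wpt r x w ∈ K := by
  rw [mem_words] at hw
  obtain ⟨-, hw⟩ := hw
  induction w with
  | nil => exact hx
  | cons b w ih =>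
    simp only [List.mem_cons, forall_eq_or_imp] at hw
    exact h.maps b hw.1 _ (ih hw.2)

theorem Sys.sep_words (h : Sys K R r Γ) (hR : 0 < R) (hK : ∀ x ∈ K, ‖x‖ ≤ R) {x : E} (hx : x ∈ K)
    {k : ℕ} {u v : List E} (hu : u ∈ words Γ k) (hv : v ∈ words Γ k) (huv : u ≠ v) :
    4 * R * r ^ k ≤ ‖wpt r x u - wpt r x v‖ := by
  have hr := h.r_pos
  induction k generalizing u v with
  | zero => simp [words] at hu hv; simp [hu, hv] at huv
  | succ k ih =>
    obtain ⟨b, u', rfl⟩ : ∃ b u', u = b :: u' := by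
      cases u with
      | nil => simp [mem_words] at hu
      | cons b u => exact ⟨b, u, rfl⟩
    obtain ⟨c, v', rfl⟩ : ∃ b u', v = b :: u' := by
      cases v with
      | nil => simp [mem_words] at hv
      | cons b u => exact ⟨b, u, rfl⟩
    have hu' : u' ∈ words Γ k ∧ b ∈ Γ := by
      simp [mem_words] at hu ⊢; tauto
    have hv' : v' ∈ words Γ k ∧ c ∈ Γ := by
      simp [mem_words] at hv ⊢; tauto
    have e : wpt r x (b :: u') - wpt r x (c :: v') =
        (b - c) + r • (wpt r x u' - wpt r x v') := by
      simp only [wpt, smul_sub]; abel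
    rw [e]
    by_cases hbc : b = c
    · subst hbc
      have hne : u' ≠ v' := by rintro rfl; exact huv rfl
      have := ih hu'.1 hv'.1 hne
      rw [sub_self, zero_add, norm_smul, Real.norm_of_nonneg hr.le, pow_succ]
      nlinarith
    · have h1 := h.sep b hu'.2 c hv'.2 hbc
      have h2 : ‖wpt r x u' - wpt r x v'‖ ≤ 2 * R := by
        refine (norm_sub_le _ _).trans ?_
        linarith [hK _ (h.wpt_mem hu'.1 hx), hK _ (h.wpt_mem hv'.1 hx)]
      rcases Nat.eq_zero_or_pos k with rfl | hk
      · have hu0 : u' = [] := by simpa [words] using hu'.1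
        have hv0 : v' = [] := by simpa [words] using hv'.1
        simpa [hu0, hv0] using h1
      · have h3 : ‖b - c‖ ≤ ‖(b - c) + r • (wpt r x u' - wpt r x v')‖ + r * (2 * R) := by
          have := norm_sub_le ((b - c) + r • (wpt r x u' - wpt r x v')) (r • (wpt r x u' - wpt r x v'))
          rw [add_sub_cancel_right, norm_smul, Real.norm_of_nonneg hr.le] at this
          nlinarith
        have h4 : r ^ k ≤ 1 / 4 := by
          calc r ^ k ≤ r ^ 1 := pow_le_pow_of_le_one hr.le (by linarith [h.r_le]) hk
            _ ≤ 1 / 4 := by simpa using h.r_le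
        have h5 : 4 * R * r ^ (k + 1) ≤ R * r := by
          rw [pow_succ]
          have : 0 < R * r := by positivity
          nlinarith
        nlinarith

theorem Sys.sep_cyl (h : Sys K R r Γ) (hR : 0 < R) (hK : ∀ x ∈ K, ‖x‖ ≤ R) {x y : E} (hx : x ∈ K)
    (hy : y ∈ K) {k : ℕ} {u v : List E} (hu : u ∈ words Γ k) (hv : v ∈ words Γ k)
    (hlt : ‖wpt r x u - wpt r y v‖ < 2 * R * r ^ k) : u = v := by
  by_contra huv
  have hr := h.r_pos
  have h1 := h.sep_words hR hK hx hu hv huv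
  have e : wpt r x u - wpt r y v = (wpt r x u - wpt r x v) + r ^ k • (x - y) := by
    rw [wpt_eq r x v, wpt_eq r y v, (mem_words.1 hv).1, smul_sub]; abel
  have h2 : ‖r ^ k • (x - y)‖ ≤ r ^ k * (2 * R) := by
    rw [norm_smul, Real.norm_of_nonneg (by positivity)]
    gcongr
    refine (norm_sub_le _ _).trans ?_
    linarith [hK _ hx, hK _ hy]
  have h3 := norm_sub_le (wpt r x u - wpt r y v) (r ^ k • (x - y))
  rw [e, add_sub_cancel_right, ← e] at h3
  linarith

theorem take_mem_words {k p : ℕ} (hp : p ≤ k) {w : List E} (hw : w ∈ words Γ k) :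
    w.take p ∈ words Γ p ∧ w.drop p ∈ words Γ (k - p) := by
  rw [mem_words] at *
  refine ⟨⟨by simp [hw.1, hp], fun b hb => hw.2 b (List.mem_of_mem_take hb)⟩,
    mem_words.2 ⟨by simp [hw.1], fun b hb => hw.2 b (List.mem_of_mem_drop hb)⟩⟩

/-- Near the point `t` the fibres are covered by few cylinders. -/
def CoverAt (f : E →L[ℝ] F) (r : ℝ) (Γ : Finset E) (x0 : E) (D : ℝ) (t : F) (ρ : ℝ) (L : ℕ) : Prop :=
  ∃ (I : Finset ℕ) (u : ℕ → List E), (∀ i ∈ I, 1 ≤ (u i).length ∧ (u i).length ≤ L) ∧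
    ∑ i ∈ I, (r ^ D) ^ (u i).length ≤ 1 ∧
    ∀ k w, L ≤ k → w ∈ words Γ k → ‖f (wpt r x0 w) - t‖ < ρ → ∃ i ∈ I, u i <+: w

theorem CoverAt.mono {f : E →L[ℝ] F} {x0 : E} {D : ℝ} {t t' : F} {ρ ρ' : ℝ} {L L' : ℕ}
    (h : CoverAt f r Γ x0 D t ρ L) (hρ : ρ' + ‖t' - t‖ ≤ ρ) (hL : L ≤ L') :
    CoverAt f r Γ x0 D t' ρ' L' := by
  obtain ⟨I, u, h1, h2, h3⟩ := h
  refine ⟨I, u, fun i hi => ⟨(h1 i hi).1, (h1 i hi).2.trans hL⟩, h2, fun k w hk hw hlt => ?_⟩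
  refine h3 k w (hL.trans hk) hw ?_
  have := norm_add_le (f (wpt r x0 w) - t') (t' - t)
  rw [sub_add_sub_cancel] at this
  linarith

theorem exists_coverAt (h : Sys K R r Γ) (hR : 0 < R) (hKR : ∀ x ∈ K, ‖x‖ ≤ R)
    (hK : IsCompact K) (f : E →L[ℝ] F) {x0 : E} (hx0 : x0 ∈ K) {D : ℝ} {t : F}
    (ht : dimH (K ∩ f ⁻¹' {t}) < ENNReal.ofReal D) :
    ∃ ρ > 0, ∃ L, CoverAt f r Γ x0 D t ρ L := by
  classical
  have hr := h.r_pos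
  have hr1 : r < 1 := by linarith [h.r_le]
  have hD : 0 < D := by
    by_contra hD
    rw [ENNReal.ofReal_of_nonpos (not_lt.mp hD)] at ht
    simp at ht
  have hS : IsCompact (K ∩ f ⁻¹' {t}) := hK.inter_right (isClosed_singleton.preimage f.continuous)
  have hκ : 0 < (R * r) ^ D := by positivity
  obtain ⟨I, c, ρ, hρ, hcov, hsum⟩ := exists_finite_ball_cover hS (Or.inl ht) hκ
  have hρle : ∀ i ∈ I, ρ i ≤ R * r := by
    intro i hi
    have : ρ i ^ D ≤ (R * r) ^ D :=
      (Finset.single_le_sum (f := fun i => ρ i ^ D) (fun j hj => Real.rpow_nonneg (hρ j hj).le _) hi).trans hsum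
    exact (Real.rpow_le_rpow_iff (hρ i hi).le (by positivity) hD).1 this
  have hp : ∀ i, ∃ p : ℕ, i ∈ I → r ^ (p + 1) < ρ i / R ∧ ρ i / R ≤ r ^ p := by
    intro i
    by_cases hi : i ∈ I
    · have h1 : ρ i / R ≤ r := by rw [div_le_iff₀ hR]; linarith [hρle i hi]
      obtain ⟨p, hp⟩ := exists_nat_pow_near_of_lt_one (div_pos (hρ i hi) hR) (by linarith) hr hr1
      exact ⟨p, fun _ => hp⟩
    · exact ⟨0, fun h => absurd h hi⟩
  choose p hp using hp
  have hp1 : ∀ i ∈ I, 1 ≤ p i := by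
    intro i hi
    by_contra hlt
    have h0 : p i = 0 := by omega
    have := (hp i hi).1
    rw [h0, zero_add, pow_one, lt_div_iff₀ hR] at this
    linarith [hρle i hi]
  -- positive distance
  set O : Set E := ⋃ i ∈ I, ball (c i) (ρ i) with hO
  have hOo : IsOpen O := isOpen_biUnion fun i _ => isOpen_ball
  have hC : IsCompact (f '' (K \ O)) := (hK.diff hOo).image f.continuous
  have htC : t ∉ f '' (K \ O) := by
    rintro ⟨y, hy, rfl⟩
    exact hy.2 (hcov ⟨hy.1, rfl⟩)
  obtain ⟨δ, hδ, hball⟩ := Metric.isOpen_iff.1 hC.isClosed.isOpen_compl t htC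
  have hu : ∀ i, ∃ u : List E, (∃ v ∈ words Γ (p i), ∃ x ∈ K, wpt r x v ∈ ball (c i) (ρ i)) →
      u ∈ words Γ (p i) ∧ ∃ x ∈ K, wpt r x u ∈ ball (c i) (ρ i) := by
    intro i
    by_cases hi : ∃ v ∈ words Γ (p i), ∃ x ∈ K, wpt r x v ∈ ball (c i) (ρ i)
    · obtain ⟨v, hv⟩ := hi
      exact ⟨v, fun _ => hv⟩
    · exact ⟨[], fun h => absurd h hi⟩
  choose u hu using hu
  set J := I.filter fun i => ∃ v ∈ words Γ (p i), ∃ x ∈ K, wpt r x v ∈ ball (c i) (ρ i) with hJ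
  have hlen : ∀ i ∈ J, (u i).length = p i := fun i hi =>
    (mem_words.1 (hu i (Finset.mem_filter.1 hi).2).1).1
  refine ⟨δ, hδ, I.sup p, J, u, ?_, ?_, ?_⟩
  · intro i hi
    have hiI := (Finset.mem_filter.1 hi).1
    rw [hlen i hi]
    exact ⟨hp1 i hiI, Finset.le_sup hiI⟩
  · calc ∑ i ∈ J, (r ^ D) ^ (u i).length ≤ ∑ i ∈ J, ρ i ^ D / (R * r) ^ D := by
          refine Finset.sum_le_sum fun i hi => ?_
          have hiI := (Finset.mem_filter.1 hi).1
          rw [hlen i hi, ← Real.rpow_mul_natCast hr.le, mul_comm, Real.rpow_natCast_mul hr.le,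
            ← Real.div_rpow (hρ i hiI).le (by positivity)]
          refine Real.rpow_le_rpow (by positivity) ?_ hD.le
          have := (hp i hiI).1
          rw [le_div_iff₀ (by positivity)]
          rw [lt_div_iff₀ hR, pow_succ] at this
          linarith
      _ ≤ ∑ i ∈ I, ρ i ^ D / (R * r) ^ D := by
          refine Finset.sum_le_sum_of_subset_of_nonneg (Finset.filter_subset _ _) fun i hi _ => ?_
          have := hρ i hi
          positivity
      _ = (∑ i ∈ I, ρ i ^ D) / (R * r) ^ D := by rw [Finset.sum_div]
      _ ≤ 1 := by rw [div_le_one hκ]; exact hsum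
  · intro k w hk hw hlt
    have hwK := h.wpt_mem hw hx0
    have hwO : wpt r x0 w ∈ O := by
      by_contra hn
      have : f (wpt r x0 w) ∈ ball t δ := by rwa [mem_ball, dist_eq_norm]
      exact hball this ⟨_, ⟨hwK, hn⟩, rfl⟩
    simp only [hO, mem_iUnion] at hwO
    obtain ⟨i, hiI, hi⟩ := hwO
    have hpk : p i ≤ k := (Finset.le_sup hiI).trans hk
    obtain ⟨ht1, ht2⟩ := take_mem_words hpk hw
    have hw2 : wpt r x0 w = wpt r (wpt r x0 (w.drop (p i))) (w.take (p i)) := by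
      rw [← wpt_append, List.take_append_drop]
    have hd := h.wpt_mem ht2 hx0
    have hex : ∃ v ∈ words Γ (p i), ∃ x ∈ K, wpt r x v ∈ ball (c i) (ρ i) :=
      ⟨_, ht1, _, hd, hw2 ▸ hi⟩
    refine ⟨i, Finset.mem_filter.2 ⟨hiI, hex⟩, ?_⟩
    obtain ⟨hu1, x, hx, hu2⟩ := hu i hex
    have heq : u i = w.take (p i) := by
      refine h.sep_cyl hR hKR hx hd hu1 ht1 ?_
      rw [← hw2, ← dist_eq_norm]
      have h1 := dist_triangle_right (wpt r x (u i)) (wpt r x0 w) (c i)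
      have h2 := (hp i hiI).2
      rw [div_le_iff₀ hR] at h2
      rw [mem_ball] at hi hu2
      linarith
    rw [heq]
    exact List.take_prefix _ _

theorem exists_uniform_coverAt (f : E →L[ℝ] F) {x0 : E} {D : ℝ} {S : Set F} (hS : IsCompact S)
    (h : ∀ t ∈ S, ∃ ρ > 0, ∃ L, CoverAt f r Γ x0 D t ρ L) :
    ∃ ρ > 0, ∃ L, ∀ t ∈ S, CoverAt f r Γ x0 D t ρ L := by
  refine hS.induction_on (p := fun S => ∃ ρ > 0, ∃ L, ∀ t ∈ S, CoverAt f r Γ x0 D t ρ L)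
    ⟨1, one_pos, 0, by simp⟩ ?_ ?_ ?_
  · rintro s t hst ⟨ρ, hρ, L, h⟩
    exact ⟨ρ, hρ, L, fun x hx => h x (hst hx)⟩
  · rintro s t ⟨ρ, hρ, L, h⟩ ⟨ρ', hρ', L', h'⟩
    refine ⟨min ρ ρ', lt_min hρ hρ', max L L', ?_⟩
    rintro x (hx | hx)
    · exact (h x hx).mono (by simp) (le_max_left _ _)
    · exact (h' x hx).mono (by simp) (le_max_right _ _)
  · intro t ht
    obtain ⟨ρ, hρ, L, hc⟩ := h t ht
    refine ⟨ball t (ρ / 2), mem_nhdsWithin_of_mem_nhds (ball_mem_nhds _ (half_pos hρ)),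
      ρ / 2, half_pos hρ, L, fun x hx => hc.mono ?_ le_rfl⟩
    rw [mem_ball, dist_eq_norm] at hx
    linarith

end Words

section Counting

variable {E F : Type*} [NormedAddCommGroup E] [NormedSpace ℝ E]
  [NormedAddCommGroup F] [NormedSpace ℝ F]
variable {K : Set E} {R r : ℝ} {Γ : Finset E}

open Classical in
/-- The number of suffixes of a word which project into `U`. -/
def visits (f : E →L[ℝ] F) (r : ℝ) (x0 : E) (U : Set F) : List E → ℕ
  | [] => 0
  | b :: w => (if f (wpt r x0 (b :: w)) ∈ U then 1 else 0) + visits f r x0 U w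

theorem visits_le_append (f : E →L[ℝ] F) (r : ℝ) (x0 : E) (U : Set F) (u w : List E) :
    visits f r x0 U w ≤ visits f r x0 U (u ++ w) := by
  induction u with
  | nil => simp
  | cons b u ih => rw [List.cons_append, visits]; omega

open Classical in
theorem sum_prefix_le (Γ : Finset E) (u : List E) (k : ℕ) (hk : u.length ≤ k) (g : List E → ℝ)
    (hg : ∀ w, 0 ≤ g w) :
    ∑ w ∈ words Γ k, (if u <+: w then g w else 0) ≤ ∑ w ∈ words Γ (k - u.length), g (u ++ w) := by
  induction u generalizing k g with
  | nil => simp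
  | cons c u ih =>
    obtain ⟨k, rfl⟩ : ∃ k', k = k' + 1 := ⟨k - 1, by simp at hk; omega⟩
    simp only [List.length_cons, add_le_add_iff_right] at hk
    rw [sum_words_succ]
    have h1 : ∑ w ∈ words Γ k, (if u <+: w then g (c :: w) else 0) ≤
        ∑ w ∈ words Γ (k - u.length), g (c :: (u ++ w)) :=
      ih k hk (fun w => g (c :: w)) (fun w => hg _)
    have h2 : ∑ b ∈ Γ, ∑ w ∈ words Γ k, (if c :: u <+: b :: w then g (b :: w) else 0) ≤
        ∑ w ∈ words Γ k, (if u <+: w then g (c :: w) else 0) := by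
      calc _ ≤ ∑ b ∈ Γ, (if b = c then ∑ w ∈ words Γ k, (if u <+: w then g (c :: w) else 0) else 0) := by
            refine Finset.sum_le_sum fun b _ => ?_
            split_ifs with hb
            · subst hb; simp [List.cons_prefix_cons]
            · refine le_of_eq (Finset.sum_eq_zero fun w _ => ?_)
              rw [if_neg]
              simp [List.cons_prefix_cons, Ne.symm hb]
        _ ≤ _ := by
            rw [Finset.sum_ite_eq']
            split_ifs
            · exact le_rfl
            · exact Finset.sum_nonneg fun w _ => by split_ifs <;> simp [hg]
    simpa using h2.trans h1

open Classical in
theorem frostman_count (h : Sys K R r Γ) (hR : 0 < R) (f : E →L[ℝ] F)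
    (hf : ∀ x ∈ K, ‖f x‖ ≤ R) {x0 : E} (hx0 : x0 ∈ K) {Q : ℝ}
    (hQ : ∀ y : F, ((Γ.filter fun b => ‖f b - y‖ ≤ 4 * R * r).card : ℝ) ≤ Q) (p l : ℕ) (y : F) :
    ∑ w ∈ words Γ (l + p), (if ‖f (wpt r x0 w) - y‖ ≤ R * r ^ p then (1 : ℝ) else 0) ≤
      Q ^ p * (Γ.card : ℝ) ^ l := by
  have hr := h.r_pos
  have hQ0 : 0 ≤ Q := (Nat.cast_nonneg _).trans (hQ 0)
  induction p generalizing y with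
  | zero =>
    calc _ ≤ ∑ w ∈ words Γ (l + 0), (1 : ℝ) :=
          Finset.sum_le_sum fun w _ => by split_ifs <;> norm_num
      _ = _ := by simp [card_words]
  | succ p ih =>
    rw [← add_assoc, sum_words_succ]
    calc _ ≤ ∑ b ∈ Γ, (if ‖f b - y‖ ≤ 4 * R * r then Q ^ p * (Γ.card : ℝ) ^ l else 0) := by
          refine Finset.sum_le_sum fun b hb => ?_
          split_ifs with hby
          · refine le_trans ?_ (ih (r⁻¹ • (y - f b)))
            refine Finset.sum_le_sum fun w hw => ?_
            have e : f (wpt r x0 (b :: w)) - y = r • (f (wpt r x0 w) - r⁻¹ • (y - f b)) := by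
              simp only [wpt, map_add, map_smul, smul_sub, smul_smul, mul_inv_cancel₀ hr.ne', one_smul]
              abel
            rw [e, norm_smul, Real.norm_of_nonneg hr.le]
            by_cases hh : ‖f (wpt r x0 w) - r⁻¹ • (y - f b)‖ ≤ R * r ^ p
            · rw [if_pos hh]; split_ifs <;> norm_num
            · rw [if_neg hh, if_neg]
              intro h'
              apply hh
              rw [pow_succ] at h'
              exact le_of_mul_le_mul_left (by linarith) hr
          · refine le_of_eq (Finset.sum_eq_zero fun w hw => ?_)
            rw [if_neg]
            intro hh
            apply hby
            have e : f b - y = (f (wpt r x0 (b :: w)) - y) - r • f (wpt r x0 w) := by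
              simp only [wpt, map_add, map_smul]; abel
            have h1 := norm_sub_le (f (wpt r x0 (b :: w)) - y) (r • f (wpt r x0 w))
            rw [← e, norm_smul, Real.norm_of_nonneg hr.le] at h1
            have h2 := hf _ (h.wpt_mem hw hx0)
            have h3 : R * r ^ (p + 1) ≤ R * r := by
              rw [pow_succ]
              have : r ^ p ≤ 1 := pow_le_one₀ hr.le (by linarith [h.r_le])
              have : 0 < R * r := by positivity
              nlinarith
            nlinarith
      _ = ((Γ.filter fun b => ‖f b - y‖ ≤ 4 * R * r).card : ℝ) * (Q ^ p * (Γ.card : ℝ) ^ l) := by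
          rw [← Finset.sum_filter]; simp
      _ ≤ Q * (Q ^ p * (Γ.card : ℝ) ^ l) := by gcongr; exact hQ y
      _ = _ := by ring

open Classical in
theorem weighted_count (h : Sys K R r Γ) (hR : 0 < R) (f : E →L[ℝ] F)
    (hf : ∀ x ∈ K, ‖f x‖ ≤ R) {x0 : E} (hx0 : x0 ∈ K) {Q : ℝ}
    (hQ : ∀ y : F, ((Γ.filter fun b => ‖f b - y‖ ≤ 4 * R * r).card : ℝ) ≤ Q)
    {D l ρ : ℝ} (hl0 : 0 ≤ l) (hl1 : l ≤ 1) (hlQ : l * Q ≤ (r ^ D)⁻¹) {U : Set F} (hρ : 0 < ρ) {L : ℕ}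
    (hcov : ∀ t ∈ f '' K \ U, CoverAt f r Γ x0 D t ρ L) :
    ∃ C > 0, ∀ (k : ℕ) (y : F),
      ∑ w ∈ words Γ k, (if ‖f (wpt r x0 w) - y‖ ≤ 5 * R * r ^ k then l ^ visits f r x0 U w else 0) ≤
        C * ((r ^ D)⁻¹) ^ k := by
  have hr := h.r_pos
  have hr1 : r < 1 := by linarith [h.r_le]
  have hQ0 : 0 ≤ Q := (Nat.cast_nonneg _).trans (hQ 0)
  set X : ℝ := (r ^ D)⁻¹ with hX
  have hrD : 0 < r ^ D := by positivity
  have hX0 : 0 < X := by positivity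
  obtain ⟨L0, hL0⟩ := exists_pow_lt_of_lt_one (show 0 < ρ / 2 / (5 * R) by positivity) hr1
  set L1 := max (max L 2) L0 with hL1
  set C : ℝ := ∑ k ∈ Finset.range (L1 + 1), ((Γ.card : ℝ) * X⁻¹) ^ k + 1 with hC
  have hC0 : 0 < C := by positivity
  have hterm : ∀ (k : ℕ) (y : F) w, 0 ≤ (if ‖f (wpt r x0 w) - y‖ ≤ 5 * R * r ^ k then l ^ visits f r x0 U w else 0) := by
    intro k y w; split_ifs <;> positivity
  refine ⟨C, hC0, fun k => ?_⟩
  induction k using Nat.strong_induction_on with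
  | _ k ih =>
  intro y
  by_cases hk : k ≤ L1
  · calc _ ≤ ∑ w ∈ words Γ k, (1 : ℝ) := by
          refine Finset.sum_le_sum fun w _ => ?_
          split_ifs
          · exact pow_le_one₀ hl0 hl1
          · norm_num
      _ = ((Γ.card : ℝ) * X⁻¹) ^ k * X ^ k := by
          rw [← mul_pow, mul_assoc, inv_mul_cancel₀ hX0.ne', mul_one]; simp [card_words]
      _ ≤ C * X ^ k := by
          gcongr
          have := Finset.single_le_sum (f := fun k => ((Γ.card : ℝ) * X⁻¹) ^ k) (s := Finset.range (L1 + 1))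
            (fun j _ => by positivity) (Finset.mem_range.2 (Nat.lt_succ_of_le hk))
          linarith
  push Not at hk
  have hkL : L ≤ k := by omega
  have hk2 : 2 ≤ k := by omega
  have hkL0 : L0 ≤ k := by omega
  have hsmall : 5 * R * r ^ k < ρ / 2 := by
    have h1 : r ^ k ≤ r ^ L0 := pow_le_pow_of_le_one hr.le hr1.le hkL0
    have h2 := h1.trans_lt hL0
    rw [lt_div_iff₀ (by positivity)] at h2
    linarith
  by_cases hy : ∃ t ∈ f '' K \ U, ‖y - t‖ < ρ / 2
  · obtain ⟨t, ht, hty⟩ := hy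
    obtain ⟨I, u, hu, hsum, hpre⟩ := hcov t ht
    calc _ ≤ ∑ w ∈ words Γ k, ∑ i ∈ I, (if u i <+: w then (if ‖f (wpt r x0 w) - y‖ ≤ 5 * R * r ^ k then l ^ visits f r x0 U w else 0) else 0) := by
          refine Finset.sum_le_sum fun w hw => ?_
          by_cases hwy : ‖f (wpt r x0 w) - y‖ ≤ 5 * R * r ^ k
          · have hlt : ‖f (wpt r x0 w) - t‖ < ρ := by
              have := norm_add_le (f (wpt r x0 w) - y) (y - t)
              rw [sub_add_sub_cancel] at this
              linarith
            obtain ⟨i, hi, hiw⟩ := hpre k w hkL hw hlt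
            refine le_trans ?_ (Finset.single_le_sum (f := fun i => (if u i <+: w then (if ‖f (wpt r x0 w) - y‖ ≤ 5 * R * r ^ k then l ^ visits f r x0 U w else 0) else 0)) (fun j _ => ?_) hi)
            · simp only [if_pos hiw]; exact le_rfl
            · split_ifs <;> positivity
          · simp [hwy]
      _ = ∑ i ∈ I, ∑ w ∈ words Γ k, (if u i <+: w then (if ‖f (wpt r x0 w) - y‖ ≤ 5 * R * r ^ k then l ^ visits f r x0 U w else 0) else 0) := Finset.sum_comm
      _ ≤ ∑ i ∈ I, (C * X ^ k) * (r ^ D) ^ (u i).length := by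
          refine Finset.sum_le_sum fun i hi => ?_
          obtain ⟨hi1, hi2⟩ := hu i hi
          have hik : (u i).length ≤ k := hi2.trans hkL
          refine (sum_prefix_le Γ (u i) k hik _ (hterm k y)).trans ?_
          set n := (u i).length with hn
          set y' : F := (r ^ n)⁻¹ • (y - f (wpt r 0 (u i))) with hy'
          have hrn : 0 < r ^ n := by positivity
          have hstep := ih (k - n) (by omega) y'
          calc _ ≤ ∑ w ∈ words Γ (k - n), (if ‖f (wpt r x0 w) - y'‖ ≤ 5 * R * r ^ (k - n) then l ^ visits f r x0 U w else 0) := by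
                refine Finset.sum_le_sum fun w hw => ?_
                have e : f (wpt r x0 (u i ++ w)) - y = r ^ n • (f (wpt r x0 w) - y') := by
                  rw [wpt_append, wpt_eq, hy']
                  simp only [map_add, map_smul, smul_sub, smul_smul, mul_inv_cancel₀ hrn.ne', one_smul]
                  abel
                rw [e, norm_smul, Real.norm_of_nonneg hrn.le]
                have epow : r ^ k = r ^ n * r ^ (k - n) := by rw [← pow_add]; congr 1; omega
                by_cases hh : ‖f (wpt r x0 w) - y'‖ ≤ 5 * R * r ^ (k - n)
                · rw [if_pos hh]
                  split_ifs
                  · exact pow_le_pow_of_le_one hl0 hl1 (visits_le_append _ _ _ _ _ _)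
                  · positivity
                · rw [if_neg hh, if_neg]
                  intro h'
                  apply hh
                  rw [epow] at h'
                  exact le_of_mul_le_mul_left (by linarith) hrn
            _ ≤ C * X ^ (k - n) := hstep
            _ = (C * X ^ k) * (r ^ D) ^ n := by
                have epow : X ^ k = X ^ (k - n) * X ^ n := by rw [← pow_add]; congr 1; omega
                have : X ^ n * (r ^ D) ^ n = 1 := by
                  rw [← mul_pow, hX, inv_mul_cancel₀ hrD.ne', one_pow]
                rw [epow, mul_assoc, mul_assoc, this, mul_one]
      _ = (C * X ^ k) * ∑ i ∈ I, (r ^ D) ^ (u i).length := by rw [Finset.mul_sum]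
      _ ≤ (C * X ^ k) * 1 := by gcongr
      _ = _ := mul_one _
  · push Not at hy
    have hU : ∀ w ∈ words Γ k, ‖f (wpt r x0 w) - y‖ ≤ 5 * R * r ^ k → f (wpt r x0 w) ∈ U := by
      intro w hw hwy
      by_contra hn
      have := hy _ ⟨⟨_, h.wpt_mem hw hx0, rfl⟩, hn⟩
      rw [norm_sub_rev] at this
      linarith
    obtain ⟨k, rfl⟩ : ∃ k', k = k' + 1 := ⟨k - 1, by omega⟩
    rw [sum_words_succ]
    calc _ ≤ ∑ b ∈ Γ, (if ‖f b - y‖ ≤ 4 * R * r then l * (C * X ^ k) else 0) := by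
          refine Finset.sum_le_sum fun b hb => ?_
          split_ifs with hby
          · refine le_trans ?_ (mul_le_mul_of_nonneg_left (ih k (by omega) (r⁻¹ • (y - f b))) hl0)
            rw [Finset.mul_sum]
            refine Finset.sum_le_sum fun w hw => ?_
            have hbw : b :: w ∈ words Γ (k + 1) := by
              rw [mem_words] at hw ⊢; simp [hw.1, hb]; exact hw.2
            have e : f (wpt r x0 (b :: w)) - y = r • (f (wpt r x0 w) - r⁻¹ • (y - f b)) := by
              simp only [wpt, map_add, map_smul, smul_sub, smul_smul, mul_inv_cancel₀ hr.ne', one_smul]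
              abel
            by_cases h' : ‖f (wpt r x0 (b :: w)) - y‖ ≤ 5 * R * r ^ (k + 1)
            · rw [if_pos h', if_pos, visits, if_pos (hU _ hbw h'), pow_add, pow_one]
              rw [e, norm_smul, Real.norm_of_nonneg hr.le, pow_succ] at h'
              exact le_of_mul_le_mul_left (by linarith) hr
            · rw [if_neg h']
              exact mul_nonneg hl0 (hterm _ _ _)
          · refine le_of_eq (Finset.sum_eq_zero fun w hw => ?_)
            rw [if_neg]
            intro hh
            apply hby
            have e : f b - y = (f (wpt r x0 (b :: w)) - y) - r • f (wpt r x0 w) := by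
              simp only [wpt, map_add, map_smul]; abel
            have h1 := norm_sub_le (f (wpt r x0 (b :: w)) - y) (r • f (wpt r x0 w))
            rw [← e, norm_smul, Real.norm_of_nonneg hr.le] at h1
            have h2 := hf _ (h.wpt_mem hw hx0)
            have h3 : 5 * R * r ^ (k + 1) ≤ 5 / 4 * (R * r) := by
              rw [pow_succ]
              have h4 : r ^ k ≤ 1 / 4 := by
                calc r ^ k ≤ r ^ 1 := pow_le_pow_of_le_one hr.le hr1.le (by omega)
                  _ ≤ 1 / 4 := by simpa using h.r_le
              have : 0 < R * r := by positivity
              nlinarith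
            nlinarith
      _ = ((Γ.filter fun b => ‖f b - y‖ ≤ 4 * R * r).card : ℝ) * (l * (C * X ^ k)) := by
          rw [← Finset.sum_filter]; simp
      _ ≤ Q * (l * (C * X ^ k)) := by gcongr; exact hQ y
      _ = (l * Q) * (C * X ^ k) := by ring
      _ ≤ X * (C * X ^ k) := by gcongr
      _ = _ := by ring

end Counting

section Core

variable {E F : Type*} [NormedAddCommGroup E] [NormedSpace ℝ E]
  [NormedAddCommGroup F] [NormedSpace ℝ F]
variable {K : Set E} {R r : ℝ} {Γ : Finset E}

open Classical in
theorem sum_visits_le (f : E →L[ℝ] F) (x0 : E) (U : Set F) {κ : ℝ} (hκ : 0 ≤ κ) (p0 : ℕ)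
    (hU : ∀ l, p0 ≤ l → ∑ w ∈ words Γ l, (if f (wpt r x0 w) ∈ U then (1 : ℝ) else 0) ≤
      κ * (Γ.card : ℝ) ^ l) (k : ℕ) :
    ∑ w ∈ words Γ k, (visits f r x0 U w : ℝ) ≤ (Γ.card : ℝ) ^ k * ((min k p0 : ℕ) + κ * k) := by
  induction k with
  | zero => simp [words, visits]
  | succ k ih =>
    have e : ∑ w ∈ words Γ (k + 1), (visits f r x0 U w : ℝ) =
        ∑ w ∈ words Γ (k + 1), (if f (wpt r x0 w) ∈ U then (1 : ℝ) else 0) +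
          (Γ.card : ℝ) * ∑ w ∈ words Γ k, (visits f r x0 U w : ℝ) := by
      rw [sum_words_succ, sum_words_succ]
      simp only [visits, Nat.cast_add, Finset.sum_add_distrib, Finset.sum_const, nsmul_eq_mul,
        Nat.cast_ite, Nat.cast_one, Nat.cast_zero]
    rw [e]
    have h2 : (Γ.card : ℝ) * ∑ w ∈ words Γ k, (visits f r x0 U w : ℝ) ≤
      (Γ.card : ℝ) * ((Γ.card : ℝ) ^ k * ((min k p0 : ℕ) + κ * k)) := by gcongr
    have hN : (0 : ℝ) ≤ (Γ.card : ℝ) ^ (k + 1) := by positivity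
    by_cases hk : p0 ≤ k + 1
    · have h1 := hU (k + 1) hk
      have h3 : ((min k p0 : ℕ) : ℝ) ≤ (min (k + 1) p0 : ℕ) := by
        exact_mod_cast min_le_min_right _ (Nat.le_succ k)
      have h4 : (Γ.card : ℝ) ^ (k + 1) * ((min k p0 : ℕ) : ℝ) ≤ (Γ.card : ℝ) ^ (k + 1) * (min (k + 1) p0 : ℕ) := by gcongr
      push_cast [pow_succ] at *
      linarith
    · have h1 : ∑ w ∈ words Γ (k + 1), (if f (wpt r x0 w) ∈ U then (1 : ℝ) else 0) ≤ (Γ.card : ℝ) ^ (k + 1) := by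
        rw [← card_words, Finset.card_eq_sum_ones, Nat.cast_sum]
        exact Finset.sum_le_sum fun w _ => by split_ifs <;> norm_num
      have e1 : min k p0 = k := by omega
      have e2 : min (k + 1) p0 = k + 1 := by omega
      rw [e1] at h2
      rw [e2]
      have h4 := mul_nonneg hκ hN
      push_cast [pow_succ] at *
      linarith

open Classical in
/-- Existence of a good homogeneous system with nearly full dimension and small multiplicity. -/
def Good (K : Set E) (f : E →L[ℝ] F) (R s η q : ℝ) : Prop :=
  ∃ (r : ℝ) (Γ : Finset E), Sys K R r Γ ∧ r ^ (-(s - η)) ≤ (Γ.card : ℝ) ∧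
    ∀ y : F, ((Γ.filter fun b => ‖f b - y‖ ≤ 4 * R * r).card : ℝ) ≤ r ^ (-q)

theorem isCompact_exceptional (f : E →L[ℝ] F) (hK : IsCompact K) (x0 : E) (D : ℝ) :
    IsCompact (f '' K \ {t | ∃ ρ > 0, ∃ L, CoverAt f r Γ x0 D t ρ L}) := by
  refine (hK.image f.continuous).diff ?_
  rw [Metric.isOpen_iff]
  rintro t ⟨ρ, hρ, L, h⟩
  refine ⟨ρ / 2, half_pos hρ, fun x hx => ⟨ρ / 2, half_pos hρ, L, h.mono ?_ le_rfl⟩⟩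
  rw [mem_ball, dist_eq_norm] at hx
  linarith

open Classical in
theorem exists_small_nhd (h : Sys K R r Γ) (hR : 0 < R) (f : E →L[ℝ] F)
    (hf : ∀ x ∈ K, ‖f x‖ ≤ R) {x0 : E} (hx0 : x0 ∈ K) {Q τ : ℝ}
    (hQ : ∀ y : F, ((Γ.filter fun b => ‖f b - y‖ ≤ 4 * R * r).card : ℝ) ≤ Q)
    (hQN : Q ≤ r ^ τ * Γ.card) {A : Set F} (hA : IsCompact A)
    (hdim : dimH A < ENNReal.ofReal τ ∨ A = ∅) :
    ∃ U : Set F, IsOpen U ∧ A ⊆ U ∧ ∃ p0 : ℕ, ∀ l, p0 ≤ l →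
      ∑ w ∈ words Γ l, (if f (wpt r x0 w) ∈ U then (1 : ℝ) else 0) ≤ 1 / 8 * (Γ.card : ℝ) ^ l := by
  have hr := h.r_pos
  have hr1 : r < 1 := by linarith [h.r_le]
  have hQ0 : 0 ≤ Q := (Nat.cast_nonneg _).trans (hQ 0)
  rcases A.eq_empty_or_nonempty with rfl | hne
  · refine ⟨∅, isOpen_empty, subset_rfl, 0, fun l _ => ?_⟩
    simp only [mem_empty_iff_false, if_false, Finset.sum_const_zero]
    positivity
  have hdim : dimH A < ENNReal.ofReal τ := by
    rcases hdim with h | h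
    · exact h
    · exact absurd h hne.ne_empty
  have hτ : 0 < τ := by
    by_contra hD
    rw [ENNReal.ofReal_of_nonpos (not_lt.mp hD)] at hdim
    simp at hdim
  have hRr : 0 < (R * r) ^ τ := by positivity
  obtain ⟨I, c, ρ, hρ, hcov, hsum⟩ := exists_finite_ball_cover hA (Or.inl hdim)
    (show 0 < 1 / 8 * (R * r) ^ τ by positivity)
  have hρle : ∀ i ∈ I, ρ i ≤ R * r := by
    intro i hi
    have : ρ i ^ τ ≤ (R * r) ^ τ := by
      have := (Finset.single_le_sum (f := fun i => ρ i ^ τ) (fun j hj => Real.rpow_nonneg (hρ j hj).le _) hi).trans hsum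
      linarith
    exact (Real.rpow_le_rpow_iff (hρ i hi).le (by positivity) hτ).1 this
  have hp : ∀ i, ∃ p : ℕ, i ∈ I → r ^ (p + 1) < ρ i / R ∧ ρ i / R ≤ r ^ p := by
    intro i
    by_cases hi : i ∈ I
    · have h1 : ρ i / R ≤ r := by rw [div_le_iff₀ hR]; linarith [hρle i hi]
      obtain ⟨p, hp⟩ := exists_nat_pow_near_of_lt_one (div_pos (hρ i hi) hR) (by linarith) hr hr1
      exact ⟨p, fun _ => hp⟩
    · exact ⟨0, fun h => absurd h hi⟩
  choose p hp using hp
  refine ⟨⋃ i ∈ I, ball (c i) (ρ i), isOpen_biUnion fun i _ => isOpen_ball, hcov, I.sup p,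
    fun l hl => ?_⟩
  calc _ ≤ ∑ w ∈ words Γ l, ∑ i ∈ I, (if ‖f (wpt r x0 w) - c i‖ ≤ R * r ^ p i then (1 : ℝ) else 0) := by
        refine Finset.sum_le_sum fun w _ => ?_
        split_ifs with hw
        · simp only [mem_iUnion] at hw
          obtain ⟨i, hi, hiw⟩ := hw
          refine le_trans ?_ (Finset.single_le_sum (f := fun i => (if ‖f (wpt r x0 w) - c i‖ ≤ R * r ^ p i then (1 : ℝ) else 0)) (fun j _ => ?_) hi)
          · rw [if_pos]
            rw [mem_ball, dist_eq_norm] at hiw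
            have := (hp i hi).2
            rw [div_le_iff₀ hR] at this
            linarith
          · split_ifs <;> norm_num
        · exact Finset.sum_nonneg fun i _ => by split_ifs <;> norm_num
    _ = ∑ i ∈ I, ∑ w ∈ words Γ l, (if ‖f (wpt r x0 w) - c i‖ ≤ R * r ^ p i then (1 : ℝ) else 0) := Finset.sum_comm
    _ ≤ ∑ i ∈ I, ρ i ^ τ / (R * r) ^ τ * (Γ.card : ℝ) ^ l := by
        refine Finset.sum_le_sum fun i hi => ?_
        have hpl : p i ≤ l := (Finset.le_sup hi).trans hl
        have h1 := frostman_count h hR f hf hx0 hQ (p i) (l - p i) (c i)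
        rw [Nat.sub_add_cancel hpl] at h1
        refine h1.trans ?_
        calc Q ^ p i * (Γ.card : ℝ) ^ (l - p i) ≤ (r ^ τ * Γ.card) ^ p i * (Γ.card : ℝ) ^ (l - p i) := by gcongr
          _ = (r ^ τ) ^ p i * (Γ.card : ℝ) ^ l := by
              rw [mul_pow, mul_assoc, ← pow_add, Nat.add_sub_cancel' hpl]
          _ ≤ _ := by
              gcongr
              rw [← Real.rpow_mul_natCast hr.le, mul_comm, Real.rpow_natCast_mul hr.le,
                ← Real.div_rpow (hρ i hi).le (by positivity)]
              refine Real.rpow_le_rpow (by positivity) ?_ hτ.le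
              have := (hp i hi).1
              rw [le_div_iff₀ (by positivity)]
              rw [lt_div_iff₀ hR, pow_succ] at this
              linarith
    _ = (∑ i ∈ I, ρ i ^ τ) / (R * r) ^ τ * (Γ.card : ℝ) ^ l := by rw [← Finset.sum_mul, Finset.sum_div]
    _ ≤ _ := by
        refine mul_le_mul_of_nonneg_right ?_ (by positivity)
        rw [div_le_iff₀ hRr]; exact hsum

open Classical in
theorem core_step (hK : IsCompact K) (hR : 0 < R) (hKR : ∀ x ∈ K, ‖x‖ ≤ R) (f : E →L[ℝ] F)
    (hf : ∀ x ∈ K, ‖f x‖ ≤ R) {x0 : E} (hx0 : x0 ∈ K) {s Δ ε τ : ℝ} (hε : 0 < ε)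
    (hgood : ∀ q > Δ, ∀ η > 0, Good K f R s η q)
    (hτ : τ < s - Δ)
    (hA : dimH {y | y ∈ f '' K ∧ ENNReal.ofReal (Δ - ε) ≤ dimH (K ∩ f ⁻¹' {y})} < ENNReal.ofReal τ ∨
      {y | y ∈ f '' K ∧ ENNReal.ofReal (Δ - ε) ≤ dimH (K ∩ f ⁻¹' {y})} = ∅)
    {η : ℝ} (hη : 0 < η) : Good K f R s η (Δ - ε / 8) := by
  set D := Δ - ε with hD
  set θ := min (ε / 2) ((s - Δ - τ) / 2) with hθ
  have hθ0 : 0 < θ := lt_min (by linarith) (by linarith)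
  have hθ1 : θ ≤ ε / 2 := min_le_left _ _
  have hθ2 : θ ≤ (s - Δ - τ) / 2 := min_le_right _ _
  set η' := min (η / 2) ((s - Δ - τ) / 2) with hη'
  have hη0 : 0 < η' := lt_min (by linarith) (by linarith)
  have hη1 : η' ≤ η / 2 := min_le_left _ _
  have hη2 : η' ≤ (s - Δ - τ) / 2 := min_le_right _ _
  obtain ⟨r, Γ, h, hN, hQ⟩ := hgood (Δ + θ) (by linarith) η' hη0
  have hr := h.r_pos
  have hr1 : r < 1 := by linarith [h.r_le]
  set A := {y | y ∈ f '' K ∧ ENNReal.ofReal D ≤ dimH (K ∩ f ⁻¹' {y})} with hAdef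
  set A' := f '' K \ {t | ∃ ρ > 0, ∃ L, CoverAt f r Γ x0 D t ρ L} with hA'
  have hA'c : IsCompact A' := isCompact_exceptional f hK x0 D
  have hsub : A' ⊆ A := by
    rintro y ⟨hy1, hy2⟩
    refine ⟨hy1, ?_⟩
    by_contra hn
    exact hy2 (exists_coverAt h hR hKR hK f hx0 (not_le.1 hn))
  have hdim : dimH A' < ENNReal.ofReal τ ∨ A' = ∅ := by
    rcases hA with hA | hA
    · exact Or.inl ((dimH_mono hsub).trans_lt hA)
    · exact Or.inr (subset_empty_iff.1 (hA ▸ hsub))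
  have hQN : r ^ (-(Δ + θ)) ≤ r ^ τ * Γ.card := by
    calc r ^ (-(Δ + θ)) ≤ r ^ (τ + -(s - η')) :=
          Real.rpow_le_rpow_of_exponent_ge hr hr1.le (by linarith)
      _ = r ^ τ * r ^ (-(s - η')) := Real.rpow_add hr _ _
      _ ≤ _ := by gcongr
  obtain ⟨U, hUo, hAU, p0, hU⟩ := exists_small_nhd h hR f hf hx0 hQ hQN hA'c hdim
  obtain ⟨ρ, hρ, L, hcov⟩ := exists_uniform_coverAt (r := r) (Γ := Γ) f (x0 := x0) (D := D)
    ((hK.image f.continuous).diff hUo) (fun t ht => by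
      by_contra hn
      exact ht.2 (hAU ⟨ht.1, hn⟩))
  set γ := ε + θ with hγ
  set l := r ^ γ with hl
  have hl0 : 0 < l := by positivity
  have hl1 : l ≤ 1 := Real.rpow_le_one hr.le hr1.le (by linarith)
  obtain ⟨C, hC0, hC⟩ := weighted_count h hR f hf hx0 hQ hl0.le hl1 (D := D) (U := U) (by
    rw [hl, ← Real.rpow_add hr, ← Real.rpow_neg hr.le]
    apply le_of_eq; congr 1; linarith) hρ hcov
  -- choose k
  have ht1 : ∀ᶠ k : ℕ in atTop, (r ^ k) ^ η' ≤ 1 / 2 := by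
    have : Tendsto (fun k : ℕ => (r ^ η') ^ k) atTop (𝓝 0) :=
      tendsto_pow_atTop_nhds_zero_of_lt_one (by positivity) (Real.rpow_lt_one hr.le hr1 hη0)
    filter_upwards [this.eventually (eventually_le_nhds (show (0 : ℝ) < 1 / 2 by norm_num))] with k hk
    rwa [← Real.rpow_natCast_mul hr.le, mul_comm, Real.rpow_mul_natCast hr.le]
  have ht2 : ∀ᶠ k : ℕ in atTop, (r ^ k) ^ (ε / 8) ≤ 1 / C := by
    have : Tendsto (fun k : ℕ => (r ^ (ε / 8)) ^ k) atTop (𝓝 0) :=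
      tendsto_pow_atTop_nhds_zero_of_lt_one (by positivity) (Real.rpow_lt_one hr.le hr1 (by linarith))
    filter_upwards [this.eventually (eventually_le_nhds (show (0 : ℝ) < 1 / C by positivity))] with k hk
    rwa [← Real.rpow_natCast_mul hr.le, mul_comm, Real.rpow_mul_natCast hr.le]
  obtain ⟨k, ⟨hk1, hk2⟩, hk3⟩ := ((ht1.and ht2).and (eventually_ge_atTop (8 * p0 + 1))).exists
  set x := r ^ k with hx
  have hx0' : 0 < x := by positivity
  have hxle : x ≤ 1 / 4 := by
    calc r ^ k ≤ r ^ 1 := pow_le_pow_of_le_one hr.le hr1.le (by omega)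
      _ ≤ 1 / 4 := by simpa using h.r_le
  have hx1 : x ≤ 1 := by linarith
  set G := (words Γ k).filter (fun w => 2 * visits f r x0 U w ≤ k) with hG
  have hlen : ∀ w ∈ words Γ k, w.length = k := fun w hw => (mem_words.1 hw).1
  have hsepw : ∀ u ∈ words Γ k, ∀ v ∈ words Γ k, u ≠ v → 4 * R * x ≤ ‖wpt r 0 u - wpt r 0 v‖ := by
    intro u hu v hv huv
    have := h.sep_words hR hKR hx0 hu hv huv
    rw [wpt_eq r x0 u, wpt_eq r x0 v, hlen u hu, hlen v hv, add_sub_add_right_eq_sub] at this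
    exact this
  have hinj : Set.InjOn (wpt r (0 : E)) (G : Set (List E)) := by
    intro u hu v hv huv
    by_contra hne
    have := hsepw u (Finset.mem_filter.1 hu).1 v (Finset.mem_filter.1 hv).1 hne
    rw [huv, sub_self, norm_zero] at this
    have : 0 < 4 * R * x := by positivity
    linarith
  have hcardG : (Γ.card : ℝ) ^ k / 2 ≤ G.card := by
    have h1 := sum_visits_le f x0 U (κ := 1 / 8) (by norm_num) p0 hU k
    have hNk : (0 : ℝ) ≤ (Γ.card : ℝ) ^ k := by positivity
    have hkr : (8 * p0 + 1 : ℝ) ≤ k := by exact_mod_cast hk3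
    have hmin : ((min k p0 : ℕ) : ℝ) ≤ p0 := by exact_mod_cast min_le_right _ _
    have h2 : (Γ.card : ℝ) ^ k * ((min k p0 : ℕ) + 1 / 8 * k) ≤ (Γ.card : ℝ) ^ k * (k / 4) := by
      gcongr; linarith
    have h3 : ((words Γ k).card : ℝ) = G.card + ((words Γ k).filter (fun w => ¬ 2 * visits f r x0 U w ≤ k)).card := by
      rw [hG]; exact_mod_cast (Finset.card_filter_add_card_filter_not _).symm
    have h4 : (((words Γ k).filter (fun w => ¬ 2 * visits f r x0 U w ≤ k)).card : ℝ) * (k / 2) ≤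
        ∑ w ∈ words Γ k, (visits f r x0 U w : ℝ) := by
      calc _ = ∑ w ∈ (words Γ k).filter (fun w => ¬ 2 * visits f r x0 U w ≤ k), (k / 2 : ℝ) := by simp
        _ ≤ ∑ w ∈ (words Γ k).filter (fun w => ¬ 2 * visits f r x0 U w ≤ k), (visits f r x0 U w : ℝ) := by
            refine Finset.sum_le_sum fun w hw => ?_
            have := (Finset.mem_filter.1 hw).2
            have : (k : ℝ) ≤ 2 * visits f r x0 U w := by exact_mod_cast (not_le.1 this).le
            linarith
        _ ≤ _ := Finset.sum_le_sum_of_subset_of_nonneg (Finset.filter_subset _ _)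
            (fun w _ _ => by positivity)
    rw [card_words] at h3
    have hk0 : (0 : ℝ) < k / 2 := by
      have : (0 : ℝ) ≤ p0 := by positivity
      linarith
    have h5 : (((words Γ k).filter (fun w => ¬ 2 * visits f r x0 U w ≤ k)).card : ℝ) ≤ (Γ.card : ℝ) ^ k / 2 := by
      refine le_of_mul_le_mul_right (?_ : _ * (k / 2 : ℝ) ≤ _) hk0
      linarith
    linarith
  refine ⟨x, G.image (wpt r 0), ⟨hx0', hxle, ?_, ?_⟩, ?_, ?_⟩
  · intro b hb y hy
    obtain ⟨w, hw, rfl⟩ := Finset.mem_image.1 hb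
    have hw' := (Finset.mem_filter.1 hw).1
    have := h.wpt_mem hw' hy
    rwa [wpt_eq, hlen w hw'] at this
  · intro b hb b' hb' hne
    obtain ⟨w, hw, rfl⟩ := Finset.mem_image.1 hb
    obtain ⟨w', hw', rfl⟩ := Finset.mem_image.1 hb'
    exact hsepw w (Finset.mem_filter.1 hw).1 w' (Finset.mem_filter.1 hw').1 (by rintro rfl; exact hne rfl)
  · rw [Finset.card_image_of_injOn hinj]
    refine le_trans ?_ hcardG
    calc x ^ (-(s - η)) ≤ x ^ (-(s - η') + η') :=
          Real.rpow_le_rpow_of_exponent_ge hx0' hx1 (by linarith)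
      _ = x ^ (-(s - η')) * x ^ η' := Real.rpow_add hx0' _ _
      _ ≤ x ^ (-(s - η')) * (1 / 2) := by gcongr
      _ = (r ^ (-(s - η'))) ^ k * (1 / 2) := by
          rw [hx, ← Real.rpow_natCast_mul hr.le, mul_comm (k : ℝ), Real.rpow_mul_natCast hr.le]
      _ ≤ (Γ.card : ℝ) ^ k * (1 / 2) := by gcongr
      _ = _ := by ring
  · intro y
    set H := G.filter (fun w => ‖f (wpt r x0 w) - y‖ ≤ 5 * R * x) with hH
    have hle : (((G.image (wpt r 0)).filter fun b => ‖f b - y‖ ≤ 4 * R * x).card : ℝ) ≤ H.card := by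
      rw [Finset.filter_image]
      refine Nat.cast_le.2 (Finset.card_image_le.trans (Finset.card_le_card ?_))
      intro w hw
      simp only [Finset.mem_filter] at hw
      refine Finset.mem_filter.2 ⟨hw.1, ?_⟩
      have hw' := (Finset.mem_filter.1 hw.1).1
      have e : f (wpt r x0 w) - y = (f (wpt r 0 w) - y) + x • f x0 := by
        rw [wpt_eq, hlen w hw']; simp only [map_add, map_smul]; rw [hx]; abel
      rw [e]
      refine (norm_add_le _ _).trans ?_
      rw [norm_smul, Real.norm_of_nonneg hx0'.le]
      have := hf x0 hx0
      nlinarith [hw.2]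
    have hpow : x ^ (γ / 2) = l ^ ((k : ℝ) / 2) := by
      rw [hl, hx, ← Real.rpow_natCast_mul hr.le, ← Real.rpow_mul hr.le]; congr 1; ring
    have hcount : (H.card : ℝ) * x ^ (γ / 2) ≤ C * x ^ (-D) := by
      calc (H.card : ℝ) * x ^ (γ / 2) = ∑ w ∈ H, x ^ (γ / 2) := by simp
        _ ≤ ∑ w ∈ H, (if ‖f (wpt r x0 w) - y‖ ≤ 5 * R * r ^ k then l ^ visits f r x0 U w else 0) := by
            refine Finset.sum_le_sum fun w hw => ?_
            obtain ⟨hwG, hwy⟩ := Finset.mem_filter.1 hw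
            rw [if_pos hwy, hpow, ← Real.rpow_natCast]
            refine Real.rpow_le_rpow_of_exponent_ge hl0 hl1 ?_
            have : (2 * visits f r x0 U w : ℝ) ≤ k := by exact_mod_cast (Finset.mem_filter.1 hwG).2
            linarith
        _ ≤ ∑ w ∈ words Γ k, (if ‖f (wpt r x0 w) - y‖ ≤ 5 * R * r ^ k then l ^ visits f r x0 U w else 0) :=
            Finset.sum_le_sum_of_subset_of_nonneg
              ((Finset.filter_subset _ _).trans (Finset.filter_subset _ _))
              (fun w _ _ => by split_ifs <;> positivity)
        _ ≤ C * ((r ^ D)⁻¹) ^ k := hC k y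
        _ = C * x ^ (-D) := by
            rw [hx, ← Real.rpow_natCast_mul hr.le, mul_comm (k : ℝ), Real.rpow_mul_natCast hr.le,
              Real.rpow_neg hr.le]
    have hCx : C ≤ x ^ (-(ε / 8)) := by
      rw [Real.rpow_neg hx0'.le, ← one_div]
      rw [le_div_iff₀ (by positivity)]
      rw [le_div_iff₀ hC0] at hk2
      linarith
    refine hle.trans ?_
    have hxp : 0 < x ^ (γ / 2) := by positivity
    refine le_of_mul_le_mul_right (hcount.trans ?_) hxp
    calc C * x ^ (-D) ≤ x ^ (-(ε / 8)) * x ^ (-D) := by gcongr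
      _ = x ^ (-(ε / 8) + -D) := (Real.rpow_add hx0' _ _).symm
      _ ≤ x ^ (-(Δ - ε / 8) + γ / 2) :=
          Real.rpow_le_rpow_of_exponent_ge hx0' hx1 (by rw [hD, hγ]; linarith)
      _ = _ := Real.rpow_add hx0' _ _

theorem core_theorem (hK : IsCompact K) (hR : 0 < R) (hKR : ∀ x ∈ K, ‖x‖ ≤ R) (f : E →L[ℝ] F)
    (hf : ∀ x ∈ K, ‖f x‖ ≤ R) {x0 : E} (hx0 : x0 ∈ K) {s : ℝ}
    (hs : dimH K = ENNReal.ofReal s)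
    (hex : ∀ η > 0, ∃ (r : ℝ) (Γ : Finset E), Sys K R r Γ ∧ r ^ (-(s - η)) ≤ (Γ.card : ℝ)) :
    ∃ Δ : ℝ, 0 ≤ Δ ∧ ∀ ε : ℝ, 0 < ε →
      {y | y ∈ f '' K ∧ ENNReal.ofReal (Δ - ε) ≤ dimH (K ∩ f ⁻¹' {y})}.Nonempty ∧
      dimH K ≤ ENNReal.ofReal Δ +
        dimH {y | y ∈ f '' K ∧ ENNReal.ofReal (Δ - ε) ≤ dimH (K ∩ f ⁻¹' {y})} := by
  classical
  -- the set of admissible exponents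
  set S : Set ℝ := {q | ∀ η > 0, Good K f R s η q} with hS
  have hbdd : ∀ q ∈ S, 0 ≤ q := by
    intro q hq
    obtain ⟨r, Γ, h, hN, hQ⟩ := hq 1 one_pos
    have hr := h.r_pos
    have hr1 : r < 1 := by linarith [h.r_le]
    have hpos : (0 : ℝ) < Γ.card := lt_of_lt_of_le (by positivity) hN
    obtain ⟨b, hb⟩ : Γ.Nonempty := Finset.card_pos.1 (by exact_mod_cast hpos)
    by_contra hq0
    have h1 := hQ (f b)
    have h2 : (1 : ℝ) ≤ ((Γ.filter fun c => ‖f c - f b‖ ≤ 4 * R * r).card : ℝ) := by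
      have : 0 < (Γ.filter fun c => ‖f c - f b‖ ≤ 4 * R * r).card :=
        Finset.card_pos.2 ⟨b, Finset.mem_filter.2 ⟨hb, by rw [sub_self, norm_zero]; positivity⟩⟩
      exact_mod_cast this
    have h3 : r ^ (-q) < 1 := Real.rpow_lt_one hr.le hr1 (by linarith)
    linarith
  have hne : (max s 0 + 1) ∈ S := by
    intro η hη
    obtain ⟨r, Γ, h, hN⟩ := hex η hη
    have hr := h.r_pos
    have hr1 : r < 1 := by linarith [h.r_le]
    have hle : ⌈r ^ (-(s - η))⌉₊ ≤ Γ.card := Nat.ceil_le.2 hN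
    obtain ⟨Γ', hsub, hcard⟩ := Finset.exists_subset_card_eq hle
    refine ⟨r, Γ', ⟨h.r_pos, h.r_le, fun b hb => h.maps b (hsub hb),
      fun b hb b' hb' => h.sep b (hsub hb) b' (hsub hb')⟩, ?_, fun y => ?_⟩
    · rw [hcard]; exact Nat.le_ceil _
    · have h1 : ((Γ'.filter fun b => ‖f b - y‖ ≤ 4 * R * r).card : ℝ) ≤ Γ'.card :=
        Nat.cast_le.2 (Finset.card_filter_le _ _)
      have h2 : (Γ'.card : ℝ) ≤ r ^ (-(s - η)) + 1 := by
        rw [hcard]; exact (Nat.ceil_lt_add_one (by positivity)).le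
      have h3 : r ^ (-(s - η)) ≤ r ^ (-(max s 0)) :=
        Real.rpow_le_rpow_of_exponent_ge hr hr1.le (by linarith [le_max_left s 0])
      have h4 : (1 : ℝ) ≤ r ^ (-(max s 0)) :=
        Real.one_le_rpow_of_pos_of_le_one_of_nonpos hr hr1.le (by linarith [le_max_right s 0])
      have h5 : r ^ (-(max s 0 + 1)) = r ^ (-(max s 0)) * r⁻¹ := by
        rw [neg_add, Real.rpow_add hr, Real.rpow_neg_one]
      have h6 : 2 ≤ r⁻¹ := by
        rw [le_inv_comm₀ (by norm_num) hr]; linarith [h.r_le]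
      rw [h5]
      nlinarith
  have hbb : BddBelow S := ⟨0, hbdd⟩
  set Δ := sInf S with hΔ
  have hΔ0 : 0 ≤ Δ := le_csInf ⟨_, hne⟩ hbdd
  have hgood : ∀ q > Δ, ∀ η > 0, Good K f R s η q := by
    intro q hq η hη
    obtain ⟨q', hq', hlt⟩ := exists_lt_of_csInf_lt ⟨_, hne⟩ hq
    obtain ⟨r, Γ, h, hN, hQ⟩ := hq' η hη
    exact ⟨r, Γ, h, hN, fun y => (hQ y).trans
      (Real.rpow_le_rpow_of_exponent_ge h.r_pos (by linarith [h.r_le]) (by linarith))⟩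
  refine ⟨Δ, hΔ0, fun ε hε => ?_⟩
  by_contra hcon
  set A := {y | y ∈ f '' K ∧ ENNReal.ofReal (Δ - ε) ≤ dimH (K ∩ f ⁻¹' {y})} with hA
  have hτ : ∃ τ, τ < s - Δ ∧ (dimH A < ENNReal.ofReal τ ∨ A = ∅) := by
    rcases A.eq_empty_or_nonempty with h | h
    · exact ⟨s - Δ - 1, by linarith, Or.inr h⟩
    · have h1 : ENNReal.ofReal Δ + dimH A < ENNReal.ofReal s := by
        rw [← hs]
        by_contra hle
        exact hcon ⟨h, not_lt.1 hle⟩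
      have h2 : dimH A < ENNReal.ofReal (s - Δ) := by
        rw [ENNReal.ofReal_sub _ hΔ0]
        exact lt_tsub_iff_left.2 h1
      obtain ⟨τ, hτ0, hτ1, hτ2⟩ := ENNReal.lt_iff_exists_real_btwn.1 h2
      exact ⟨τ, (ENNReal.ofReal_lt_ofReal_iff_of_nonneg hτ0).1 hτ2, Or.inl hτ1⟩
  obtain ⟨τ, hτ1, hτ2⟩ := hτ
  have hmem : Δ - ε / 8 ∈ S := fun η hη => core_step hK hR hKR f hf hx0 hε hgood hτ1 hτ2 hη
  have := csInf_le hbb hmem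
  linarith

end Core

section Box

/-- A maximal separated set at some small scale has many points. -/
theorem exists_separated {X : Type*} [MetricSpace X] {K : Set X} (hK : IsCompact K)
    (hne : K.Nonempty) {s D c ρ0 : ℝ} (hs : dimH K = ENNReal.ofReal s) (hD : D < s)
    (hc : 0 < c) (hρ0 : 0 < ρ0) :
    ∃ (ρ : ℝ) (P : Finset X), 0 < ρ ∧ ρ < ρ0 ∧ ρ < 1 ∧ (∀ x ∈ P, x ∈ K) ∧
      (∀ x ∈ P, ∀ y ∈ P, x ≠ y → c * ρ ≤ dist x y) ∧ ρ ^ (-D) ≤ (P.card : ℝ) := by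
  classical
  obtain ⟨x0, hx0⟩ := hne
  rcases lt_or_ge D 0 with hD0 | hD0
  · refine ⟨min ρ0 1 / 2, {x0}, by positivity, ?_, ?_, by simpa using hx0, ?_, ?_⟩
    · have := min_le_left ρ0 1; have : 0 < min ρ0 1 := by positivity
      linarith
    · have := min_le_right ρ0 1; have : 0 < min ρ0 1 := by positivity
      linarith
    · intro x hx y hy hxy
      simp only [Finset.mem_singleton] at hx hy
      exact absurd (hx.trans hy.symm) hxy
    · simp only [Finset.card_singleton, Nat.cast_one]
      apply Real.rpow_le_one (by positivity)
      · have := min_le_right ρ0 1; have : 0 < min ρ0 1 := by positivity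
        linarith
      · linarith
  by_contra hcon
  push Not at hcon
  letI : MeasurableSpace X := borel X
  haveI : BorelSpace X := ⟨rfl⟩
  -- covers
  have hcov : ∀ ρ : ℝ, 0 < ρ → ρ < ρ0 → ρ < 1 → ∃ P : Finset X,
      K ⊆ (⋃ x : P, closedBall (x : X) (c * ρ)) ∧ (P.card : ℝ) < ρ ^ (-D) := by
    intro ρ h0 h1 h2
    have hcon' := fun P => hcon ρ P h0 h1 h2
    -- all separated finsets have bounded card; take a maximal one
    let Q : ℕ → Prop := fun k => ∃ P : Finset X, P.card = k ∧ (∀ x ∈ P, x ∈ K) ∧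
      (∀ x ∈ P, ∀ y ∈ P, x ≠ y → c * ρ ≤ dist x y)
    have hb : ∀ k, Q k → k ≤ ⌈ρ ^ (-D)⌉₊ := by
      rintro k ⟨P, rfl, hP1, hP2⟩
      have := hcon' P hP1 hP2
      exact_mod_cast this.le.trans (Nat.le_ceil _)
    have hQ0 : Q 0 := ⟨∅, by simp, by simp, by simp⟩
    obtain ⟨P, hPc, hP1, hP2⟩ := Nat.findGreatest_spec (P := Q) (Nat.zero_le ⌈ρ ^ (-D)⌉₊) hQ0
    refine ⟨P, ?_, hcon' P hP1 hP2⟩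
    intro z hz
    by_contra hzn
    simp only [mem_iUnion, mem_closedBall, not_exists, not_le] at hzn
    have hzP : z ∉ P := by
      intro h
      have := hzn ⟨z, h⟩
      simp only [dist_self] at this
      nlinarith
    have hQ1 : Q (P.card + 1) := by
      refine ⟨insert z P, Finset.card_insert_of_notMem hzP, ?_, ?_⟩
      · intro x hx
        rcases Finset.mem_insert.1 hx with rfl | hx
        · exact hz
        · exact hP1 x hx
      · intro x hx y hy hxy
        rcases Finset.mem_insert.1 hx with hx1 | hx1 <;>
          rcases Finset.mem_insert.1 hy with hy1 | hy1
        · exact absurd (hx1.trans hy1.symm) hxy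
        · rw [hx1]; exact (hzn ⟨y, hy1⟩).le
        · rw [hy1, dist_comm]; exact (hzn ⟨x, hx1⟩).le
        · exact hP2 x hx1 y hy1 hxy
    have := Nat.le_findGreatest (hb _ hQ1) hQ1
    omega
  -- a sequence of scales
  obtain ⟨n0, hn0⟩ := exists_nat_gt (max (1 / ρ0) 1)
  set ρ : ℕ → ℝ := fun k => 1 / ((k : ℝ) + n0) with hρ
  have hn0' : (0 : ℝ) < n0 := lt_of_lt_of_le one_pos ((le_max_right _ _).trans hn0.le)
  have hρpos : ∀ k, 0 < ρ k := fun k => by simp only [hρ]; positivity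
  have hρle : ∀ k, ρ k ≤ 1 / n0 := fun k => by
    simp only [hρ]; apply one_div_le_one_div_of_le hn0'; linarith [(Nat.cast_nonneg k : (0:ℝ) ≤ k)]
  have hρ1 : ∀ k, ρ k < ρ0 := fun k => by
    refine (hρle k).trans_lt ?_
    rw [div_lt_comm₀ hn0' hρ0]
    exact (le_max_left _ _).trans_lt hn0
  have hρ2 : ∀ k, ρ k < 1 := fun k => by
    refine (hρle k).trans_lt ?_
    rw [div_lt_one hn0']
    exact (le_max_right _ _).trans_lt hn0
  choose P hPcov hPcard using fun k => hcov (ρ k) (hρpos k) (hρ1 k) (hρ2 k)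
  have hρt : Tendsto ρ atTop (𝓝 0) := by
    have : Tendsto (fun k : ℕ => (k : ℝ) + n0) atTop atTop :=
      tendsto_atTop_add_const_right _ _ tendsto_natCast_atTop_atTop
    have h1 := this.inv_tendsto_atTop
    refine h1.congr fun k => ?_
    simp [hρ]
  set d : ℝ≥0∞ := ENNReal.ofReal ((2 * c) ^ D) with hd
  have hmeas : μH[D] K ≤ d := by
    have h1 := Measure.hausdorffMeasure_le_liminf_sum (X := X) (l := atTop) D K
      (fun k => ENNReal.ofReal (2 * c * ρ k))
      (by
        have : Tendsto (fun k => 2 * c * ρ k) atTop (𝓝 0) := by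
          simpa using hρt.const_mul (2 * c)
        simpa using (ENNReal.tendsto_ofReal this))
      (fun k (x : P k) => closedBall (x : X) (c * ρ k))
      (Eventually.of_forall fun k x => by
        refine Metric.ediam_le_of_forall_dist_le (fun y hy z hz => ?_)
        have := dist_triangle_right y z x
        rw [mem_closedBall] at hy hz
        linarith)
      (Eventually.of_forall fun k => hPcov k)
    refine h1.trans ?_
    refine liminf_le_of_le (by isBoundedDefault) ?_
    intro b hb
    obtain ⟨k, hk⟩ := hb.exists
    refine hk.trans ?_
    calc ∑ x : P k, ediam (closedBall (x : X) (c * ρ k)) ^ D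
        ≤ ∑ x : P k, ENNReal.ofReal ((2 * c * ρ k) ^ D) := by
          apply Finset.sum_le_sum
          intro x _
          rw [← ENNReal.ofReal_rpow_of_pos (by have := hρpos k; positivity)]
          apply ENNReal.rpow_le_rpow _ hD0
          refine Metric.ediam_le_of_forall_dist_le (fun y hy z hz => ?_)
          have := dist_triangle_right y z x
          rw [mem_closedBall] at hy hz
          linarith
      _ = ENNReal.ofReal ((P k).card * (2 * c * ρ k) ^ D) := by
          rw [Finset.sum_const, Finset.card_univ, Fintype.card_coe, nsmul_eq_mul,
            ENNReal.ofReal_mul (by positivity), ENNReal.ofReal_natCast]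
      _ ≤ d := by
          apply ENNReal.ofReal_le_ofReal
          have h3 := hρpos k
          calc ((P k).card : ℝ) * (2 * c * ρ k) ^ D ≤ ρ k ^ (-D) * (2 * c * ρ k) ^ D := by
                gcongr; exact (hPcard k).le
            _ = (2 * c) ^ D := by
                rw [Real.mul_rpow (by positivity) h3.le, Real.rpow_neg h3.le]
                field_simp
  have hdim : dimH K ≤ ENNReal.ofReal D := by
    have := dimH_le_of_hausdorffMeasure_ne_top (d := ⟨D, hD0⟩) (s := K)
      (by
        refine ne_top_of_le_ne_top ?_ hmeas
        simp [hd])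
    rwa [ENNReal.ofReal_eq_coe_nnreal hD0]
  rw [hs, ENNReal.ofReal_le_ofReal_iff hD0] at hdim
  linarith

end Box

section Graph

/-- Composition of the maps along a path. -/
def pathMap {Edge X : Type*} (g : Edge → X → X) : List Edge → X → X
  | [], x => x
  | e :: p, x => g e (pathMap g p x)

theorem pathMap_append {Edge X : Type*} (g : Edge → X → X) (p q : List Edge) (x : X) :
    pathMap g (p ++ q) x = pathMap g p (pathMap g q x) := by
  induction p with
  | nil => rfl
  | cons e p ih => simp [pathMap, ih]

theorem IsPathFrom.append {V Edge : Type*} {src tgt : Edge → V} {i j k : V} {p q : List Edge}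
    (hp : IsPathFrom src tgt i j p) (hq : IsPathFrom src tgt j k q) :
    IsPathFrom src tgt i k (p ++ q) := by
  induction p generalizing i with
  | nil =>
    have : i = j := hp
    subst this; simpa using hq
  | cons e p ih => exact ⟨hp.1, ih hp.2⟩

theorem IsPathFrom.repl {V Edge : Type*} {src tgt : Edge → V} {i : V} {p : List Edge}
    (hp : IsPathFrom src tgt i i p) (k : ℕ) :
    IsPathFrom src tgt i i (List.replicate k p).flatten := by
  induction k with
  | zero => exact rfl
  | succ k ih => simpa [List.replicate_succ] using hp.append ih

theorem exists_uniform_pos {ι : Type*} {G : Set ι} (hG : G.Finite) {Q : ι → ℝ → Prop}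
    (hanti : ∀ S c c', 0 < c' → c' ≤ c → Q S c → Q S c')
    (h : ∀ S ∈ G, ∃ c > 0, Q S c) : ∃ c > 0, ∀ S ∈ G, Q S c := by
  have h1 : ∀ᶠ c in 𝓝[>] (0 : ℝ), ∀ S ∈ G, Q S c := by
    rw [eventually_all_finite hG]
    intro S hS
    obtain ⟨c, hc, hQ⟩ := h S hS
    filter_upwards [Ioc_mem_nhdsGT hc] with c' hc'
    exact hanti S c c' hc'.1 hc'.2 hQ
  obtain ⟨c, h2, h3⟩ := (h1.and self_mem_nhdsWithin).exists
  exact ⟨c, h3, h2⟩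

variable {n M : ℕ} {Edge : Type} {src tgt : Edge → Fin M}
    {a : Edge → ℝ}
    {T : Edge → (EuclideanSpace ℝ (Fin n) ≃ₗᵢ[ℝ] EuclideanSpace ℝ (Fin n))}
    {bvec : Edge → EuclideanSpace ℝ (Fin n)}
    {g : Edge → EuclideanSpace ℝ (Fin n) → EuclideanSpace ℝ (Fin n)}
    {K : Fin M → Set (EuclideanSpace ℝ (Fin n))}

theorem pathMap_affine (hg : ∀ e x, g e x = a e • T e x + bvec e) (p : List Edge) :
    ∃ b, ∀ x, pathMap g p x = (p.map a).prod • (p.map T).prod x + b := by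
  induction p with
  | nil => exact ⟨0, fun x => by simp [pathMap]⟩
  | cons e p ih =>
    obtain ⟨b, hb⟩ := ih
    refine ⟨a e • T e b + bvec e, fun x => ?_⟩
    simp only [pathMap, hg, hb, List.map_cons, List.prod_cons, map_add, map_smul,
      LinearIsometryEquiv.coe_mul, Function.comp_apply, smul_add, smul_smul]
    abel

theorem pathMap_mem (hinv : ∀ j, K j = ⋃ (e : Edge), ⋃ (_ : src e = j), g e '' K (tgt e))
    {p : List Edge} {j k : Fin M} (hp : IsPathFrom src tgt j k p)
    {x : EuclideanSpace ℝ (Fin n)} (hx : x ∈ K k) : pathMap g p x ∈ K j := by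
  induction p generalizing j with
  | nil =>
    have : j = k := hp
    subst this; exact hx
  | cons e p ih =>
    rw [hinv j]
    simp only [mem_iUnion]
    exact ⟨e, hp.1, mem_image_of_mem _ (ih hp.2)⟩

theorem prod_pos_le {amax : ℝ} (ha : ∀ e, 0 < a e ∧ a e ≤ amax) (p : List Edge) :
    0 < (p.map a).prod ∧ (p.map a).prod ≤ amax ^ p.length := by
  induction p with
  | nil => simp
  | cons e p ih =>
    simp only [List.map_cons, List.prod_cons, List.length_cons, pow_succ']
    refine ⟨mul_pos (ha e).1 ih.1, ?_⟩
    exact mul_le_mul (ha e).2 ih.2 ih.1.le ((ha e).1.le.trans (ha e).2)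

theorem exists_path (hinv : ∀ j, K j = ⋃ (e : Edge), ⋃ (_ : src e = j), g e '' K (tgt e))
    {amin amax : ℝ} (hamin : 0 < amin) (hmin : ∀ e, amin ≤ a e) (hmax : ∀ e, a e ≤ amax)
    (hlt : amax < 1) (hmax0 : 0 < amax) (N : ℕ) :
    ∀ (ρ : ℝ) (j : Fin M), 0 < ρ → amax ^ N ≤ ρ → ∀ x ∈ K j, ∃ (p : List Edge) (k : Fin M),
      IsPathFrom src tgt j k p ∧ (∃ z ∈ K k, x = pathMap g p z) ∧ (p.map a).prod ≤ ρ ∧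
      min 1 (amin * ρ) ≤ (p.map a).prod := by
  induction N with
  | zero =>
    intro ρ j _ hρ x hx
    exact ⟨[], j, rfl, ⟨x, hx, rfl⟩, by simpa using hρ, by simp⟩
  | succ N ih =>
    intro ρ j hρ0 hρ x hx
    rcases le_or_gt 1 ρ with h1 | h1
    · exact ⟨[], j, rfl, ⟨x, hx, rfl⟩, by simpa using h1, by simp⟩
    have hx' := hx
    rw [hinv j] at hx'
    simp only [mem_iUnion] at hx'
    obtain ⟨e, he, y, hy, rfl⟩ := hx'
    have hae : 0 < a e := hamin.trans_le (hmin e)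
    obtain ⟨p, k, hp, ⟨z, hz, hzy⟩, hle, hge⟩ := ih (ρ / a e) (tgt e) (by positivity)
      (by
        rw [le_div_iff₀ hae]
        refine le_trans ?_ hρ
        rw [pow_succ]
        exact mul_le_mul_of_nonneg_left (hmax e) (by positivity)) y hy
    refine ⟨e :: p, k, ⟨he, hp⟩, ⟨z, hz, by simp [pathMap, hzy]⟩, ?_, ?_⟩
    · rw [le_div_iff₀ hae] at hle
      simp only [List.map_cons, List.prod_cons]; linarith
    · simp only [List.map_cons, List.prod_cons]
      refine (min_le_right _ _).trans ?_
      rcases min_le_iff.1 hge with h | h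
      · calc amin * ρ ≤ amin * 1 := by gcongr
          _ ≤ a e := by linarith [hmin e]
          _ ≤ a e * (p.map a).prod := by nlinarith
      · rw [← mul_div_assoc, div_le_iff₀ hae] at h
        linarith

theorem exists_inverse_path {i : Fin M} (ha : ∀ e, 0 < a e)
    (hfin : ((transfGroup src tgt T i :
      Set (EuclideanSpace ℝ (Fin n) ≃ₗᵢ[ℝ] EuclideanSpace ℝ (Fin n)))).Finite) :
    ∃ c > 0, ∀ w : List Edge, w ≠ [] → IsPathFrom src tgt i i w →
      ∃ u : List Edge, IsPathFrom src tgt i i u ∧ (w.map T).prod * (u.map T).prod = 1 ∧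
        c ≤ (u.map a).prod := by
  have hpos : ∀ u : List Edge, 0 < (u.map a).prod := by
    intro u
    apply List.prod_pos
    simp only [List.mem_map]
    rintro _ ⟨e, _, rfl⟩
    exact ha e
  obtain ⟨c, hc, h⟩ := exists_uniform_pos hfin
    (Q := fun S c => ∀ w : List Edge, w ≠ [] → IsPathFrom src tgt i i w → S = (w.map T).prod →
      ∃ u : List Edge, IsPathFrom src tgt i i u ∧ S * (u.map T).prod = 1 ∧
        c ≤ (u.map a).prod)
    (by
      intro S c c' _ hcc h w h1 h2 h3
      obtain ⟨u, h4, h5, h6⟩ := h w h1 h2 h3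
      exact ⟨u, h4, h5, hcc.trans h6⟩)
    (by
      intro S hS
      by_cases hw : ∃ w : List Edge, IsPathFrom src tgt i i w ∧ S = (w.map T).prod
      · obtain ⟨w, hw, hSw⟩ := hw
        haveI : Finite (transfGroup src tgt T i) := hfin
        obtain ⟨k, hk, hk1⟩ := (isOfFinOrder_iff_pow_eq_one.1
          (isOfFinOrder_of_finite (⟨S, hS⟩ : transfGroup src tgt T i)))
        have hk2 : S ^ k = 1 := by
          have := congrArg Subtype.val hk1
          simpa using this
        refine ⟨_, hpos (List.replicate (k - 1) w).flatten, fun w' _ _ _ =>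
          ⟨_, hw.repl (k - 1), ?_, le_rfl⟩⟩
        have : ((List.replicate (k - 1) w).flatten.map T).prod = S ^ (k - 1) := by
          rw [List.map_flatten, List.prod_flatten]
          simp [← hSw]
        rw [this, ← pow_succ', Nat.sub_add_cancel hk, hk2]
      · exact ⟨1, one_pos, fun w _ h1 h2 => absurd ⟨w, h1, h2⟩ hw⟩)
  refine ⟨c, hc, fun w h1 h2 => ?_⟩
  exact h _ (Subgroup.subset_closure ⟨w, h1, h2, rfl⟩) w h1 h2 rfl

theorem graph_maps [Finite Edge] (ha : ∀ e, 0 < a e ∧ a e < 1)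
    (hg : ∀ e x, g e x = a e • T e x + bvec e)
    (htrans : ∀ i j : Fin M, ∃ p : List Edge, p ≠ [] ∧ IsPathFrom src tgt i j p)
    (hinv : ∀ j, K j = ⋃ (e : Edge), ⋃ (_ : src e = j), g e '' K (tgt e))
    {i : Fin M} (hfin : ((transfGroup src tgt T i :
      Set (EuclideanSpace ℝ (Fin n) ≃ₗᵢ[ℝ] EuclideanSpace ℝ (Fin n)))).Finite)
    {B : ℝ} (hB : ∀ j, ∀ x ∈ K j, ∀ y ∈ K j, ‖x - y‖ ≤ B) :
    ∃ c0 > 0, ∃ amax, 0 < amax ∧ amax < 1 ∧ ∀ ρ, 0 < ρ → ρ < 1 → ∀ x ∈ K i,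
      ∃ (p : List Edge) (b : EuclideanSpace ℝ (Fin n)),
      0 < (p.map a).prod ∧ (p.map a).prod ≤ amax ^ p.length ∧ c0 * ρ ≤ (p.map a).prod ∧
      (p.map a).prod ≤ ρ ∧ ∀ z ∈ K i, b + (p.map a).prod • z ∈ K i ∧
        ‖b + (p.map a).prod • z - x‖ ≤ B * ρ := by
  obtain ⟨amin, hamin, hmin⟩ := exists_uniform_pos (finite_univ (α := Edge))
    (Q := fun e c => c ≤ a e ∧ c ≤ 1 - a e)
    (fun S c c' _ h h' => ⟨h.trans h'.1, h.trans h'.2⟩)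
    (fun e _ => ⟨min (a e) (1 - a e), lt_min (ha e).1 (by linarith [(ha e).2]),
      min_le_left _ _, min_le_right _ _⟩)
  obtain ⟨e0, -⟩ : ∃ e : Edge, True := by
    obtain ⟨p, hp, _⟩ := htrans i i
    cases p with
    | nil => exact absurd rfl hp
    | cons e p => exact ⟨e, trivial⟩
  have hmin1 : ∀ e, amin ≤ a e := fun e => (hmin e trivial).1
  have hmax1 : ∀ e, a e ≤ 1 - amin := fun e => by linarith [(hmin e trivial).2]
  have hamax0 : 0 < 1 - amin := (ha e0).1.trans_le (hmax1 e0)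
  have hprod : ∀ p : List Edge, 0 < (p.map a).prod ∧ (p.map a).prod ≤ (1 - amin) ^ p.length :=
    prod_pos_le fun e => ⟨(ha e).1, hmax1 e⟩
  have hprod1 : ∀ p : List Edge, (p.map a).prod ≤ 1 := fun p =>
    (hprod p).2.trans (pow_le_one₀ hamax0.le (by linarith))
  choose q hq1 hq2 using fun j => htrans j i
  obtain ⟨c1, hc1, hq3⟩ := exists_uniform_pos (finite_univ (α := Fin M))
    (Q := fun j c => c ≤ ((q j).map a).prod) (fun S c c' _ h h' => h.trans h')
    (fun j _ => ⟨_, (hprod (q j)).1, le_rfl⟩)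
  obtain ⟨c2, hc2, hu⟩ := exists_inverse_path (a := a) (fun e => (ha e).1) hfin
  refine ⟨amin * c1 * c2, by positivity, 1 - amin, hamax0, by linarith, ?_⟩
  intro ρ hρ hρ1 x hx
  obtain ⟨N, hN⟩ := exists_pow_lt_of_lt_one hρ (by linarith : 1 - amin < 1)
  obtain ⟨p, j, hp, ⟨z, hz, hxz⟩, hple, hpge⟩ := exists_path hinv hamin hmin1 hmax1
    (by linarith) hamax0 N ρ i hρ hN.le x hx
  have hpge' : amin * ρ ≤ (p.map a).prod := by
    rwa [min_eq_right (by nlinarith)] at hpge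
  obtain ⟨u, hu1, hu2, hu3⟩ := hu (p ++ q j) (by simp [hq1 j]) (hp.append (hq2 j))
  set w := p ++ (q j ++ u) with hw
  have hwT : (w.map T).prod = 1 := by
    rw [hw, ← List.append_assoc, List.map_append, List.prod_append]; exact hu2
  obtain ⟨b, hb⟩ := pathMap_affine hg w
  have hb' : ∀ x, pathMap g w x = b + (w.map a).prod • x := by
    intro x; rw [hb, hwT]; simp [add_comm]
  have hwa : (w.map a).prod = (p.map a).prod * (((q j).map a).prod * (u.map a).prod) := by
    simp [hw]
  refine ⟨w, b, (hprod w).1, (hprod w).2, ?_, ?_, ?_⟩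
  · rw [hwa]
    have h1 : c1 * c2 ≤ ((q j).map a).prod * (u.map a).prod :=
      mul_le_mul (hq3 j trivial) hu3 hc2.le (hprod _).1.le
    calc amin * c1 * c2 * ρ = (amin * ρ) * (c1 * c2) := by ring
      _ ≤ _ := mul_le_mul hpge' h1 (by positivity) (hprod _).1.le
  · rw [hwa]
    have h1 : ((q j).map a).prod * (u.map a).prod ≤ 1 :=
      mul_le_one₀ (hprod1 _) (hprod _).1.le (hprod1 _)
    have := (hprod p).1
    nlinarith
  · intro y hy
    rw [← hb']
    have hy' : pathMap g (q j ++ u) y ∈ K j := pathMap_mem hinv ((hq2 j).append hu1) hy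
    have hwp : pathMap g w y = pathMap g p (pathMap g (q j ++ u) y) := by
      rw [hw, pathMap_append]
    rw [hwp]
    refine ⟨pathMap_mem hinv hp hy', ?_⟩
    obtain ⟨b', hb''⟩ := pathMap_affine hg p
    rw [hxz, hb'', hb'', add_sub_add_right_eq_sub, ← smul_sub, ← map_sub, norm_smul,
      LinearIsometryEquiv.norm_map, Real.norm_of_nonneg (hprod p).1.le, mul_comm]
    exact mul_le_mul (hB j _ hy' _ hz) hple (hprod p).1.le ((norm_nonneg _).trans (hB j _ hy' _ hz))

end Graph

section Final

theorem small_scale {c0 amax s η : ℝ} (hc0 : 0 < c0) (ham0 : 0 < amax) (ham1 : amax < 1)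
    (hη : 0 < η) (k : ℕ) :
    ∃ ρ0 > 0, ∀ ρ, 0 < ρ → ρ < ρ0 → ρ < 1 → ∃ L : ℕ,
      (∀ m : ℕ, c0 * ρ ≤ amax ^ m → m ≤ L) ∧
      ∀ r, c0 * ρ ≤ r → r ≤ ρ →
        r ^ (-(s - η)) ≤ ρ ^ (-(s - η / 2)) / ((L : ℝ) + 1) ^ k := by
  set δ : ℝ := η / (4 * (k + 1)) with hδ
  have hδ0 : 0 < δ := by positivity
  set lam : ℝ := - Real.log amax with hlam
  have hlam0 : 0 < lam := by have := Real.log_neg ham0 ham1; linarith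
  set C1 : ℝ := max 1 (c0 ^ (-(s - η))) with hC1
  set C2 : ℝ := (|Real.log c0| + 1 / δ) / lam + 2 with hC2
  have hC1p : 1 ≤ C1 := le_max_left _ _
  have hC2p : 0 < C2 := by positivity
  have hev : ∀ᶠ x : ℝ in atTop, C1 * C2 ^ k ≤ x ^ (η / 4) :=
    (tendsto_rpow_atTop (by positivity)).eventually_ge_atTop _
  obtain ⟨X, hX⟩ := eventually_atTop.1 hev
  refine ⟨1 / max X 1, by positivity, ?_⟩
  intro ρ hρ hρ0 hρ1
  have hXρ : X ≤ 1 / ρ := by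
    rw [lt_div_comm₀ hρ (by positivity)] at hρ0
    exact (le_max_left _ _).trans hρ0.le
  have h1 := hX _ hXρ
  have hinv1 : 1 ≤ 1 / ρ := by rw [le_div_iff₀ hρ]; linarith
  have hpow1 : 1 ≤ (1 / ρ) ^ δ := Real.one_le_rpow hinv1 hδ0.le
  have hlogpos : 0 ≤ Real.log (1 / ρ) := Real.log_nonneg hinv1
  have hlog : Real.log (1 / ρ) ≤ (1 / ρ) ^ δ / δ := Real.log_le_rpow_div (by positivity) hδ0
  set Y : ℝ := (|Real.log c0| + Real.log (1 / ρ)) / lam with hY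
  have hY0 : 0 ≤ Y := by positivity
  refine ⟨⌈Y⌉₊, ?_, ?_⟩
  · intro m hm
    have h2 := Real.log_le_log (by positivity) hm
    rw [Real.log_mul hc0.ne' hρ.ne', Real.log_pow] at h2
    have h3 : (m : ℝ) ≤ Y := by
      rw [hY, le_div_iff₀ hlam0, hlam, one_div, Real.log_inv]
      have := neg_abs_le (Real.log c0)
      linarith
    exact_mod_cast h3.trans (Nat.le_ceil _)
  · intro r hr1 hr2
    have hr0 : 0 < r := lt_of_lt_of_le (by positivity) hr1
    have hL : (⌈Y⌉₊ : ℝ) + 1 ≤ C2 * (1 / ρ) ^ δ := by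
      have h2 := (Nat.ceil_lt_add_one hY0).le
      have h3 : Y ≤ ((|Real.log c0| + 1 / δ) / lam) * (1 / ρ) ^ δ := by
        rw [hY, div_mul_eq_mul_div]
        apply div_le_div_of_nonneg_right _ hlam0.le
        have h4 : |Real.log c0| ≤ |Real.log c0| * (1 / ρ) ^ δ :=
          le_mul_of_one_le_right (abs_nonneg _) hpow1
        calc _ ≤ |Real.log c0| * (1 / ρ) ^ δ + (1 / ρ) ^ δ / δ := add_le_add h4 hlog
          _ = _ := by ring
      rw [hC2, add_mul]
      linarith
    have hLk : ((⌈Y⌉₊ : ℝ) + 1) ^ k ≤ C2 ^ k * (1 / ρ) ^ (η / 4) := by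
      calc ((⌈Y⌉₊ : ℝ) + 1) ^ k ≤ (C2 * (1 / ρ) ^ δ) ^ k := by gcongr
        _ = C2 ^ k * (1 / ρ) ^ (δ * k) := by
            rw [mul_pow, Real.rpow_mul_natCast (by positivity)]
        _ ≤ _ := by
            gcongr
            rw [hδ, div_mul_eq_mul_div, div_le_div_iff₀ (by positivity) (by positivity)]
            have : (0 : ℝ) ≤ k := Nat.cast_nonneg k
            nlinarith
    have hrt : r ^ (-(s - η)) ≤ C1 * (1 / ρ) ^ (s - η) := by
      have ht0 : 0 < r / ρ := by positivity
      have ht : (r / ρ) ^ (-(s - η)) ≤ C1 := by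
        rcases le_total 0 (-(s - η)) with h | h
        · refine le_trans (Real.rpow_le_one ht0.le ?_ h) hC1p
          rw [div_le_one hρ]; exact hr2
        · refine le_trans ?_ (le_max_right _ _)
          apply Real.rpow_le_rpow_of_nonpos hc0 _ h
          rw [le_div_iff₀ hρ]; exact hr1
      have : r ^ (-(s - η)) = (r / ρ) ^ (-(s - η)) * (1 / ρ) ^ (s - η) := by
        rw [Real.div_rpow hr0.le hρ.le, one_div, Real.inv_rpow hρ.le, Real.rpow_neg hρ.le]
        field_simp
      rw [this]
      gcongr
    rw [le_div_iff₀ (by positivity)]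
    calc r ^ (-(s - η)) * ((⌈Y⌉₊ : ℝ) + 1) ^ k
        ≤ (C1 * (1 / ρ) ^ (s - η)) * (C2 ^ k * (1 / ρ) ^ (η / 4)) := by gcongr
      _ = (C1 * C2 ^ k) * ((1 / ρ) ^ (s - η) * (1 / ρ) ^ (η / 4)) := by ring
      _ ≤ (1 / ρ) ^ (η / 4) * ((1 / ρ) ^ (s - η) * (1 / ρ) ^ (η / 4)) := by gcongr
      _ = (1 / ρ) ^ (η / 4 + ((s - η) + η / 4)) := by
          rw [Real.rpow_add (by positivity), Real.rpow_add (by positivity)]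
      _ = ρ ^ (-(s - η / 2)) := by
          rw [one_div, Real.inv_rpow hρ.le, ← Real.rpow_neg hρ.le]
          congr 1; ring

theorem exists_sys {n M : ℕ} {Edge : Type} [Fintype Edge] {src tgt : Edge → Fin M}
    {a : Edge → ℝ}
    {T : Edge → (EuclideanSpace ℝ (Fin n) ≃ₗᵢ[ℝ] EuclideanSpace ℝ (Fin n))}
    {bvec : Edge → EuclideanSpace ℝ (Fin n)}
    {g : Edge → EuclideanSpace ℝ (Fin n) → EuclideanSpace ℝ (Fin n)}
    {K : Fin M → Set (EuclideanSpace ℝ (Fin n))} (ha : ∀ e, 0 < a e ∧ a e < 1)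
    (hg : ∀ e x, g e x = a e • T e x + bvec e)
    (htrans : ∀ i j : Fin M, ∃ p : List Edge, p ≠ [] ∧ IsPathFrom src tgt i j p)
    (hKc : ∀ j, IsCompact (K j)) (hKne : ∀ j, (K j).Nonempty)
    (hinv : ∀ j, K j = ⋃ (e : Edge), ⋃ (_ : src e = j), g e '' K (tgt e))
    {i : Fin M} (hfin : ((transfGroup src tgt T i :
      Set (EuclideanSpace ℝ (Fin n) ≃ₗᵢ[ℝ] EuclideanSpace ℝ (Fin n)))).Finite)
    {R s η : ℝ} (hR : 0 < R) (hs : dimH (K i) = ENNReal.ofReal s) (hη : 0 < η) :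
    ∃ (r : ℝ) (Γ : Finset (EuclideanSpace ℝ (Fin n))),
      Sys (K i) R r Γ ∧ r ^ (-(s - η)) ≤ (Γ.card : ℝ) := by
  classical
  obtain ⟨B, hB0, hB⟩ : ∃ B : ℝ, 0 ≤ B ∧ ∀ j, ∀ x ∈ K j, ∀ y ∈ K j, ‖x - y‖ ≤ B := by
    have hb : Bornology.IsBounded (⋃ j, K j) := (isCompact_iUnion hKc).isBounded
    refine ⟨diam (⋃ j, K j), diam_nonneg, fun j x hx y hy => ?_⟩
    rw [← dist_eq_norm]
    exact dist_le_diam_of_mem hb (mem_iUnion.2 ⟨j, hx⟩) (mem_iUnion.2 ⟨j, hy⟩)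
  obtain ⟨c0, hc0, amax, ham0, ham1, hmaps⟩ := graph_maps ha hg htrans hinv hfin hB
  obtain ⟨ρ0, hρ0, hsmall⟩ := small_scale (s := s) hc0 ham0 ham1 hη (Fintype.card Edge)
  obtain ⟨ρ, P, hρ, hρlt, hρ1, hPK, hPsep, hPcard⟩ := exists_separated (hKc i) (hKne i)
    (D := s - η / 2) (c := 4 * R + 2 * B + 1) (ρ0 := min ρ0 (1 / 4)) hs (by linarith)
    (by positivity) (by positivity)
  obtain ⟨L, hL, hcount⟩ := hsmall ρ hρ (hρlt.trans_le (min_le_left _ _)) hρ1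
  have hρ4 : ρ ≤ 1 / 4 := (hρlt.trans_le (min_le_right _ _)).le
  choose! p b hp0 hpl hpc hpρ hpm using hmaps ρ hρ hρ1
  obtain ⟨z0, hz0⟩ := hKne i
  -- pigeonhole on the edge counts
  obtain ⟨y, -, hy⟩ := Finset.exists_le_card_fiber_of_nsmul_le_card_of_maps_to
    (s := P) (t := (Finset.univ : Finset (Edge → Fin (L + 1))))
    (f := fun x e => Fin.ofNat (L + 1) ((p x).count e))
    (b := (P.card : ℝ) / ((L : ℝ) + 1) ^ Fintype.card Edge)
    (fun _ _ => Finset.mem_univ _) Finset.univ_nonempty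
    (by
      rw [Finset.card_univ, Fintype.card_fun, Fintype.card_fin, nsmul_eq_mul]
      push_cast
      rw [mul_div_cancel₀ _ (by positivity)])
  set Q := P.filter (fun x => (fun e => Fin.ofNat (L + 1) ((p x).count e)) = y) with hQ
  have hQP : ∀ x ∈ Q, x ∈ P := fun x hx => (Finset.mem_filter.1 hx).1
  have hratio : ∀ x ∈ Q, ∀ x' ∈ Q, ((p x).map a).prod = ((p x').map a).prod := by
    have hlen : ∀ x ∈ Q, ∀ e, (p x).count e < L + 1 := by
      intro x hx e
      have hxK := hPK x (hQP x hx)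
      have := hL _ ((hpc x hxK).trans (hpl x hxK))
      exact Nat.lt_succ_of_le (List.count_le_length.trans this)
    intro x hx x' hx'
    apply List.Perm.prod_eq
    apply List.Perm.map
    rw [List.perm_iff_count]
    intro e
    have h1 := congrFun ((Finset.mem_filter.1 hx).2.trans (Finset.mem_filter.1 hx').2.symm) e
    have h2 := congrArg Fin.val h1
    simp only [Fin.ofNat] at h2
    rwa [Nat.mod_eq_of_lt (hlen x hx e), Nat.mod_eq_of_lt (hlen x' hx' e)] at h2
  have hQcard : ρ ^ (-(s - η / 2)) / ((L : ℝ) + 1) ^ Fintype.card Edge ≤ (Q.card : ℝ) :=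
    le_trans (by gcongr) hy
  have hQpos : (0 : ℝ) < Q.card := lt_of_lt_of_le (by positivity) hQcard
  obtain ⟨x1, hx1⟩ : Q.Nonempty := Finset.card_pos.1 (by exact_mod_cast hQpos)
  have hx1K := hPK x1 (hQP x1 hx1)
  set r := ((p x1).map a).prod with hr
  have hrρ : r ≤ ρ := hpρ x1 hx1K
  have hm : ∀ x ∈ Q, ∀ z ∈ K i, b x + r • z ∈ K i ∧ ‖b x + r • z - x‖ ≤ B * ρ := by
    intro x hx z hz
    have := hpm x (hPK x (hQP x hx)) z hz
    rwa [hratio x hx x1 hx1] at this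
  have hsep : ∀ x ∈ Q, ∀ x' ∈ Q, x ≠ x' → (4 * R + 1) * ρ ≤ ‖b x - b x'‖ := by
    intro x hx x' hx' hne
    have h1 := (hm x hx z0 hz0).2
    have h2 := (hm x' hx' z0 hz0).2
    have h3 := hPsep x (hQP x hx) x' (hQP x' hx') hne
    rw [dist_eq_norm] at h3
    have h4 : x - x' = (b x - b x') - (b x + r • z0 - x) + (b x' + r • z0 - x') := by abel
    have h5 : ‖x - x'‖ ≤ ‖b x - b x'‖ + B * ρ + B * ρ := by
      rw [h4]
      refine (norm_add_le _ _).trans (add_le_add ((norm_sub_le _ _).trans ?_) h2)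
      exact add_le_add le_rfl h1
    linarith
  refine ⟨r, Q.image b, ⟨hp0 x1 hx1K, hrρ.trans hρ4, ?_, ?_⟩, ?_⟩
  · intro c hc z hz
    obtain ⟨x, hx, rfl⟩ := Finset.mem_image.1 hc
    exact (hm x hx z hz).1
  · intro c hc c' hc' hne
    obtain ⟨x, hx, rfl⟩ := Finset.mem_image.1 hc
    obtain ⟨x', hx', rfl⟩ := Finset.mem_image.1 hc'
    have := hsep x hx x' hx' (fun h => hne (by rw [h]))
    nlinarith
  · rw [Finset.card_image_of_injOn]
    · exact (hcount r (hpc x1 hx1K) hrρ).trans hQcard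
    · intro x hx x' hx' hxx
      by_contra hne
      have := hsep x hx x' hx' hne
      rw [hxx, sub_self, norm_zero] at this
      nlinarith

end Final

/-- **Farkas' theorem.** If `(K₁, …, K_M)` is the attractor of a graph-directed IFS in
`ℝⁿ`, `i` is a vertex whose transformation group is finite, and `f : ℝⁿ → ℝᵐ` is linear,
then `f` is almost dimension conserving for `K_i`: there is `Δ ≥ 0` such that for every
`ε > 0`, `Δ + dim {y ∈ f(K_i) : dim (K_i ∩ f⁻¹(y)) ≥ Δ − ε} ≥ dim K_i` (the convention
`dim ∅ = −∞` being encoded by requiring that set of `y` to be nonempty). -/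
theorem graphDirected_almost_dimension_conservation {n m : ℕ} (M : ℕ) (hM : 1 ≤ M)
    (Edge : Type) [Fintype Edge] (src tgt : Edge → Fin M)
    (a : Edge → ℝ) (ha : ∀ e, 0 < a e ∧ a e < 1)
    (T : Edge → (EuclideanSpace ℝ (Fin n) ≃ₗᵢ[ℝ] EuclideanSpace ℝ (Fin n)))
    (bvec : Edge → EuclideanSpace ℝ (Fin n))
    (g : Edge → EuclideanSpace ℝ (Fin n) → EuclideanSpace ℝ (Fin n))
    (hg : ∀ e x, g e x = a e • T e x + bvec e)
    (htrans : ∀ i j : Fin M, ∃ p : List Edge, p ≠ [] ∧ IsPathFrom src tgt i j p)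
    (K : Fin M → Set (EuclideanSpace ℝ (Fin n)))
    (hKc : ∀ j, IsCompact (K j)) (hKne : ∀ j, (K j).Nonempty)
    (hinv : ∀ j, K j = ⋃ (e : Edge), ⋃ (_ : src e = j), g e '' K (tgt e))
    (i : Fin M) (hfin : ((transfGroup src tgt T i :
      Set (EuclideanSpace ℝ (Fin n) ≃ₗᵢ[ℝ] EuclideanSpace ℝ (Fin n)))).Finite)
    (f : EuclideanSpace ℝ (Fin n) →ₗ[ℝ] EuclideanSpace ℝ (Fin m)) :
    ∃ Δ : ℝ, 0 ≤ Δ ∧ ∀ ε : ℝ, 0 < ε →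
      {y | y ∈ f '' K i ∧ ENNReal.ofReal (Δ - ε) ≤ dimH (K i ∩ f ⁻¹' {y})}.Nonempty ∧
      dimH (K i) ≤ ENNReal.ofReal Δ +
        dimH {y | y ∈ f '' K i ∧ ENNReal.ofReal (Δ - ε) ≤ dimH (K i ∩ f ⁻¹' {y})} := by
  obtain ⟨x0, hx0⟩ := hKne i
  let f' : EuclideanSpace ℝ (Fin n) →L[ℝ] EuclideanSpace ℝ (Fin m) :=
    LinearMap.toContinuousLinearMap f
  obtain ⟨R1, hR1⟩ := (hKc i).isBounded.exists_norm_le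
  have hfK : IsCompact (f' '' K i) := (hKc i).image f'.continuous
  obtain ⟨R2, hR2⟩ := hfK.isBounded.exists_norm_le
  set R : ℝ := max 1 (max R1 R2) with hR
  have hR0 : 0 < R := lt_of_lt_of_le one_pos (le_max_left _ _)
  have hfinite : dimH (K i) ≠ ⊤ := by
    have h1 : dimH (K i) ≤ dimH (univ : Set (EuclideanSpace ℝ (Fin n))) :=
      dimH_mono (subset_univ _)
    rw [Real.dimH_univ_eq_finrank] at h1
    exact ne_top_of_le_ne_top (ENNReal.natCast_ne_top _) h1
  have hs : dimH (K i) = ENNReal.ofReal (dimH (K i)).toReal :=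
    (ENNReal.ofReal_toReal hfinite).symm
  exact core_theorem (R := R) (hKc i) hR0
    (fun x hx => (hR1 x hx).trans ((le_max_left _ _).trans (le_max_right _ _))) f'
    (fun x hx => (hR2 _ (mem_image_of_mem _ hx)).trans
      ((le_max_right _ _).trans (le_max_right _ _))) hx0 hs
    (fun η hη => exists_sys ha hg htrans hKc hKne hinv hfin hR0 hs hη)

end
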